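/- For λ, λ' ∈ 𝔫*: ξ_λ = ξ_{λ'} if and only if λ' ∈ Ξ_λ; if λ' ∉ Ξ_λ then ξ_λ and ξ_{λ'} have no common irreducible constituent; and ⟨ξ_λ, ξ_{λ'}⟩_G = |S̄_λ|/|L̄_λ| if λ' ∈ Ξ_λ, and ⟨ξ_λ, ξ_{λ'}⟩_G = 0 otherwise. -/

import Mathlib

open scoped Classical BigOperators ComplexOrder

set_option linter.unusedSectionVars false
set_option linter.unusedVariables false

noncomputable section

namespace IterChar

/-! ### Generic notions for finite groups: inner product, induction, characters -/

/-- The standard inner product `⟨f,h⟩_G = |G|⁻¹ ∑_{x ∈ G} f x * conj (h x)`. -/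
def innerG (G : Type) [Group G] (f h : G → ℂ) : ℂ :=
  (Nat.card G : ℂ)⁻¹ * ∑ᶠ x : G, f x * (starRingEnd ℂ) (h x)

/-- Induction of a function from a subgroup, via the Frobenius formula. -/
def indFun {G : Type} [Group G] (H : Subgroup G) (ψ : ↥H → ℂ) : G → ℂ :=
  fun g => (Nat.card ↥H : ℂ)⁻¹ *
    ∑ᶠ x : G, if h : x * g * x⁻¹ ∈ H then ψ ⟨x * g * x⁻¹, h⟩ else 0

/-- A function `G → ℂ` is a character if it is the trace character of some
finite-dimensional complex representation. -/
def IsCharacter (G : Type) [Group G] (f : G → ℂ) : Prop :=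
  ∃ V : FDRep ℂ G, f = FDRep.character V

/-- The set of irreducible characters of `G`: characters of norm one. -/
def Irr (G : Type) [Group G] : Set (G → ℂ) :=
  {f | IsCharacter G f ∧ innerG G f f = 1}

/-- The set of irreducible constituents of `χ`: irreducible characters with
`⟨χ, ψ⟩_G > 0` (using the complex partial order). -/
def IrrConstituents (G : Type) [Group G] (χ : G → ℂ) : Set (G → ℂ) :=
  {f | f ∈ Irr G ∧ 0 < innerG G χ f}

/-! ### Algebra groups -/

variable {F : Type} [Field F] [Fintype F] {R : Type} [Ring R] [Algebra F R] [Fintype R]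

/-- `J` is a nilpotent (non-unital) subalgebra: all products of some fixed length vanish. -/
def IsNil (J : NonUnitalSubalgebra F R) : Prop :=
  ∃ N : ℕ, ∀ l : List R, (∀ x ∈ l, x ∈ J) → l.length = N → l.prod = 0

/-- The algebra group `G = 1 + J` of a (nilpotent) subalgebra `J ⊆ R`, realized as the
subgroup of units `u` of `R` with `u - 1 ∈ J` (and `u⁻¹ - 1 ∈ J`, which is automatic
when `J` is nilpotent). -/
def algGroup (F : Type) [Field F] [Fintype F] (R : Type) [Ring R] [Algebra F R] [Fintype R]
    (J : NonUnitalSubalgebra F R) : Subgroup Rˣ where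
  carrier := {u : Rˣ | ((u : R) - 1 ∈ J) ∧ (((u⁻¹ : Rˣ) : R) - 1 ∈ J)}
  one_mem' := by
    constructor <;> · simp only [Units.val_one, inv_one, sub_self]; exact J.zero_mem
  mul_mem' := by
    rintro u v ⟨hu1, hu2⟩ ⟨hv1, hv2⟩
    constructor
    · have h : ((u * v : Rˣ) : R) - 1 =
          ((u : R) - 1) * ((v : R) - 1) + ((u : R) - 1) + ((v : R) - 1) := by
        push_cast; noncomm_ring
      rw [h]
      exact add_mem (add_mem (mul_mem hu1 hv1) hu1) hv1
    · have h : (((u * v)⁻¹ : Rˣ) : R) - 1 =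
          (((v⁻¹ : Rˣ) : R) - 1) * (((u⁻¹ : Rˣ) : R) - 1) +
            (((v⁻¹ : Rˣ) : R) - 1) + (((u⁻¹ : Rˣ) : R) - 1) := by
        rw [mul_inv_rev]; push_cast; noncomm_ring
      rw [h]
      exact add_mem (add_mem (mul_mem hv2 hu2) hv2) hu2
  inv_mem' := by
    rintro u ⟨h1, h2⟩
    exact ⟨h2, by simpa using h1⟩

theorem mem_algGroup {J : NonUnitalSubalgebra F R} {u : Rˣ} :
    u ∈ algGroup F R J ↔ ((u : R) - 1 ∈ J) ∧ (((u⁻¹ : Rˣ) : R) - 1 ∈ J) :=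
  Iff.rfl

/-- The element `X ∈ J` such that `g = 1 + X`. -/
def gElt {J : NonUnitalSubalgebra F R} (g : ↥(algGroup F R J)) : ↥J :=
  ⟨((g : Rˣ) : R) - 1, g.2.1⟩

/-- The function `θ_λ(1+X) = θ(λ(X))` on the algebra group `1 + J`. -/
def thetaFn (θ : AddChar F ℂ) (J : NonUnitalSubalgebra F R) (lam : ↥J →ₗ[F] F) :
    ↥(algGroup F R J) → ℂ :=
  fun g => θ (lam (gElt g))

/-- Left multiplication by the group element `g` as a linear endomorphism of `J`. -/
def lmulMap {J : NonUnitalSubalgebra F R} (g : ↥(algGroup F R J)) : ↥J →ₗ[F] ↥J where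
  toFun X := ⟨((g : Rˣ) : R) * (X : R), by
    have h : ((g : Rˣ) : R) * (X : R) = (((g : Rˣ) : R) - 1) * (X : R) + (X : R) := by
      noncomm_ring
    rw [h]; exact add_mem (mul_mem g.2.1 X.2) X.2⟩
  map_add' X Y := by ext; simp [mul_add]
  map_smul' c X := by ext; simp [mul_smul_comm]

/-- Right multiplication by the group element `g` as a linear endomorphism of `J`. -/
def rmulMap {J : NonUnitalSubalgebra F R} (g : ↥(algGroup F R J)) : ↥J →ₗ[F] ↥J where
  toFun X := ⟨(X : R) * ((g : Rˣ) : R), by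
    have h : (X : R) * ((g : Rˣ) : R) = (X : R) * (((g : Rˣ) : R) - 1) + (X : R) := by
      noncomm_ring
    rw [h]; exact add_mem (mul_mem X.2 g.2.1) X.2⟩
  map_add' X Y := by ext; simp [add_mul]
  map_smul' c X := by ext; simp [smul_mul_assoc]

/-- The left action of `G` on the dual space: `(gλ)(X) = λ(g⁻¹ X)`. -/
def leftAct {J : NonUnitalSubalgebra F R} (g : ↥(algGroup F R J)) (lam : ↥J →ₗ[F] F) :
    ↥J →ₗ[F] F :=
  lam.comp (lmulMap g⁻¹)

/-- The right action of `G` on the dual space: `(λg)(X) = λ(X g⁻¹)`. -/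
def rightAct {J : NonUnitalSubalgebra F R} (g : ↥(algGroup F R J)) (lam : ↥J →ₗ[F] F) :
    ↥J →ₗ[F] F :=
  lam.comp (rmulMap g⁻¹)

/-- The coadjoint action of `G` on the dual space: `λ^g(X) = λ(g X g⁻¹)`. -/
def coAct {J : NonUnitalSubalgebra F R} (g : ↥(algGroup F R J)) (lam : ↥J →ₗ[F] F) :
    ↥J →ₗ[F] F :=
  lam.comp ((lmulMap g).comp (rmulMap g⁻¹))

/-- The left orbit `Gλ`. -/
def leftOrbit (J : NonUnitalSubalgebra F R) (lam : ↥J →ₗ[F] F) : Set (↥J →ₗ[F] F) :=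
  Set.range fun g : ↥(algGroup F R J) => leftAct g lam

/-- The right orbit `λG`. -/
def rightOrbit (J : NonUnitalSubalgebra F R) (lam : ↥J →ₗ[F] F) : Set (↥J →ₗ[F] F) :=
  Set.range fun g : ↥(algGroup F R J) => rightAct g lam

/-- The two-sided orbit `GλG`. -/
def twoOrbit (J : NonUnitalSubalgebra F R) (lam : ↥J →ₗ[F] F) : Set (↥J →ₗ[F] F) :=
  {mu | ∃ g h : ↥(algGroup F R J), mu = leftAct g (rightAct h lam)}

/-- The coadjoint orbit `λ^G`. -/
def coOrbit (J : NonUnitalSubalgebra F R) (lam : ↥J →ₗ[F] F) : Set (↥J →ₗ[F] F) :=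
  Set.range fun g : ↥(algGroup F R J) => coAct g lam

/-- The right orbit of `λ` under a subgroup `H` of the algebra group. -/
def rightOrbitUnder (J : NonUnitalSubalgebra F R) (H : Subgroup ↥(algGroup F R J))
    (lam : ↥J →ₗ[F] F) : Set (↥J →ₗ[F] F) :=
  {mu | ∃ s ∈ H, mu = rightAct s lam}

/-- The Kirillov function `ψ_λ = |λ^G|^{-1/2} ∑_{μ ∈ λ^G} θ_μ`. -/
def kirillov (θ : AddChar F ℂ) (J : NonUnitalSubalgebra F R) (lam : ↥J →ₗ[F] F) :
    ↥(algGroup F R J) → ℂ :=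
  fun g => ((Real.sqrt (Nat.card ↥(coOrbit J lam)) : ℂ))⁻¹ *
    ∑ᶠ mu ∈ coOrbit J lam, thetaFn θ J mu g

/-- The supercharacter `χ_λ = (|Gλ|/|GλG|) ∑_{μ ∈ GλG} θ_μ`. -/
def superchar (θ : AddChar F ℂ) (J : NonUnitalSubalgebra F R) (lam : ↥J →ₗ[F] F) :
    ↥(algGroup F R J) → ℂ :=
  fun g => ((Nat.card ↥(leftOrbit J lam) : ℂ) / (Nat.card ↥(twoOrbit J lam) : ℂ)) *
    ∑ᶠ mu ∈ twoOrbit J lam, thetaFn θ J mu g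

/-! ### The subalgebras `𝔩_λ`, `𝔰_λ` and their iterates -/

/-- The extension of `λ : J → F` by zero to all of `R`. -/
def lamE (J : NonUnitalSubalgebra F R) (lam : ↥J →ₗ[F] F) (x : R) : F :=
  if h : x ∈ J then lam ⟨x, h⟩ else 0

theorem lamE_apply (J : NonUnitalSubalgebra F R) (lam : ↥J →ₗ[F] F) {x : R} (hx : x ∈ J) :
    lamE J lam x = lam ⟨x, hx⟩ := dif_pos hx

theorem lamE_zero (J : NonUnitalSubalgebra F R) (lam : ↥J →ₗ[F] F) : lamE J lam 0 = 0 := by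
  rw [lamE_apply J lam J.zero_mem]
  have h : (⟨(0 : R), J.zero_mem⟩ : ↥J) = 0 := Subtype.ext rfl
  rw [h, map_zero]

theorem lamE_add (J : NonUnitalSubalgebra F R) (lam : ↥J →ₗ[F] F) {x y : R}
    (hx : x ∈ J) (hy : y ∈ J) : lamE J lam (x + y) = lamE J lam x + lamE J lam y := by
  rw [lamE, lamE, lamE, dif_pos (add_mem hx hy), dif_pos hx, dif_pos hy]
  have h : (⟨x + y, add_mem hx hy⟩ : ↥J) = ⟨x, hx⟩ + ⟨y, hy⟩ := Subtype.ext rfl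
  rw [h, map_add]

theorem lamE_smul (J : NonUnitalSubalgebra F R) (lam : ↥J →ₗ[F] F) (c : F) {x : R}
    (hx : x ∈ J) : lamE J lam (c • x) = c * lamE J lam x := by
  rw [lamE, lamE, dif_pos (SMulMemClass.smul_mem c hx), dif_pos hx]
  have h : (⟨c • x, SMulMemClass.smul_mem c hx⟩ : ↥J) = c • ⟨x, hx⟩ := Subtype.ext rfl
  rw [h, map_smul]
  rfl

/-- The left kernel `𝔩` of the bilinear form `(X,Y) ↦ λ(XY)` restricted to `s × s`. -/
def lStep (J : NonUnitalSubalgebra F R) (lam : ↥J →ₗ[F] F)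
    (s : NonUnitalSubalgebra F R) (hs : s ≤ J) : NonUnitalSubalgebra F R where
  carrier := {x | x ∈ s ∧ ∀ y ∈ s, lamE J lam (x * y) = 0}
  zero_mem' := ⟨zero_mem s, fun y _ => by rw [zero_mul, lamE_zero]⟩
  add_mem' := by
    rintro a b ⟨ha1, ha2⟩ ⟨hb1, hb2⟩
    refine ⟨add_mem ha1 hb1, fun y hy => ?_⟩
    rw [add_mul, lamE_add J lam (J.mul_mem (hs ha1) (hs hy)) (J.mul_mem (hs hb1) (hs hy)),
      ha2 y hy, hb2 y hy, add_zero]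
  smul_mem' := by
    rintro c a ⟨ha1, ha2⟩
    refine ⟨SMulMemClass.smul_mem c ha1, fun y hy => ?_⟩
    rw [smul_mul_assoc, lamE_smul J lam c (J.mul_mem (hs ha1) (hs hy)), ha2 y hy, mul_zero]
  mul_mem' := by
    rintro a b ⟨ha1, ha2⟩ ⟨hb1, hb2⟩
    refine ⟨mul_mem ha1 hb1, fun y hy => ?_⟩
    rw [mul_assoc]
    exact ha2 (b * y) (mul_mem hb1 hy)

theorem lStep_le (J : NonUnitalSubalgebra F R) (lam : ↥J →ₗ[F] F)
    (s : NonUnitalSubalgebra F R) (hs : s ≤ J) : lStep J lam s hs ≤ s :=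
  fun _ hx => hx.1

/-- The left kernel `𝔰` of the bilinear form `(X,Y) ↦ λ(XY)` restricted to `s × 𝔩`. -/
def sStep (J : NonUnitalSubalgebra F R) (lam : ↥J →ₗ[F] F)
    (s : NonUnitalSubalgebra F R) (hs : s ≤ J) : NonUnitalSubalgebra F R where
  carrier := {x | x ∈ s ∧ ∀ y ∈ lStep J lam s hs, lamE J lam (x * y) = 0}
  zero_mem' := ⟨zero_mem s, fun y _ => by rw [zero_mul, lamE_zero]⟩
  add_mem' := by
    rintro a b ⟨ha1, ha2⟩ ⟨hb1, hb2⟩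
    refine ⟨add_mem ha1 hb1, fun y hy => ?_⟩
    rw [add_mul, lamE_add J lam (J.mul_mem (hs ha1) (hs hy.1)) (J.mul_mem (hs hb1) (hs hy.1)),
      ha2 y hy, hb2 y hy, add_zero]
  smul_mem' := by
    rintro c a ⟨ha1, ha2⟩
    refine ⟨SMulMemClass.smul_mem c ha1, fun y hy => ?_⟩
    rw [smul_mul_assoc, lamE_smul J lam c (J.mul_mem (hs ha1) (hs hy.1)), ha2 y hy, mul_zero]
  mul_mem' := by
    rintro a b ⟨ha1, ha2⟩ ⟨hb1, hb2⟩
    refine ⟨mul_mem ha1 hb1, fun y hy => ?_⟩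
    rw [mul_assoc]
    refine ha2 (b * y) ⟨mul_mem hb1 hy.1, fun z hz => ?_⟩
    rw [mul_assoc]
    refine hb2 (y * z) ⟨mul_mem hy.1 hz, fun w hw => ?_⟩
    rw [mul_assoc]
    exact hy.2 (z * w) (mul_mem hz hw)

theorem sStep_le (J : NonUnitalSubalgebra F R) (lam : ↥J →ₗ[F] F)
    (s : NonUnitalSubalgebra F R) (hs : s ≤ J) : sStep J lam s hs ≤ s :=
  fun _ hx => hx.1

/-- `𝔩_λ`: the left kernel of `(X,Y) ↦ λ(XY)` on `J × J`. -/
def lone (J : NonUnitalSubalgebra F R) (lam : ↥J →ₗ[F] F) : NonUnitalSubalgebra F R :=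
  lStep J lam J le_rfl

/-- `𝔰_λ`: the left kernel of `(X,Y) ↦ λ(XY)` on `J × 𝔩_λ`. -/
def sone (J : NonUnitalSubalgebra F R) (lam : ↥J →ₗ[F] F) : NonUnitalSubalgebra F R :=
  sStep J lam J le_rfl

theorem lone_le (J : NonUnitalSubalgebra F R) (lam : ↥J →ₗ[F] F) : lone J lam ≤ J :=
  lStep_le J lam J le_rfl

theorem sone_le (J : NonUnitalSubalgebra F R) (lam : ↥J →ₗ[F] F) : sone J lam ≤ J :=
  sStep_le J lam J le_rfl

/-- `𝔨_λ = 𝔩_λ ∩ ker λ`. -/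
def kone (J : NonUnitalSubalgebra F R) (lam : ↥J →ₗ[F] F) : NonUnitalSubalgebra F R where
  carrier := {x | x ∈ lone J lam ∧ lamE J lam x = 0}
  zero_mem' := ⟨zero_mem _, lamE_zero J lam⟩
  add_mem' := by
    rintro a b ⟨ha1, ha2⟩ ⟨hb1, hb2⟩
    exact ⟨add_mem ha1 hb1, by
      rw [lamE_add J lam (lone_le J lam ha1) (lone_le J lam hb1), ha2, hb2, add_zero]⟩
  smul_mem' := by
    rintro c a ⟨ha1, ha2⟩
    exact ⟨SMulMemClass.smul_mem c ha1, by
      rw [lamE_smul J lam c (lone_le J lam ha1), ha2, mul_zero]⟩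
  mul_mem' := by
    rintro a b ⟨ha1, ha2⟩ ⟨hb1, hb2⟩
    exact ⟨mul_mem ha1 hb1, ha1.2 b (lone_le J lam hb1)⟩

theorem kone_le (J : NonUnitalSubalgebra F R) (lam : ↥J →ₗ[F] F) : kone J lam ≤ lone J lam :=
  fun _ hx => hx.1

/-- The descending chain `𝔰_λ^0 ⊇ 𝔰_λ^1 ⊇ ⋯` (bundled with the proof `𝔰_λ^i ≤ J`). -/
def sChainAux (J : NonUnitalSubalgebra F R) (lam : ↥J →ₗ[F] F) :
    ℕ → {s : NonUnitalSubalgebra F R // s ≤ J}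
  | 0 => ⟨J, le_rfl⟩
  | n + 1 =>
    ⟨sStep J lam (sChainAux J lam n).1 (sChainAux J lam n).2,
      le_trans (sStep_le J lam (sChainAux J lam n).1 (sChainAux J lam n).2)
        (sChainAux J lam n).2⟩

/-- `𝔰_λ^i`. -/
def sChain (J : NonUnitalSubalgebra F R) (lam : ↥J →ₗ[F] F) (i : ℕ) :
    NonUnitalSubalgebra F R :=
  (sChainAux J lam i).1

/-- `𝔩_λ^{i+1}`. -/
def lChain (J : NonUnitalSubalgebra F R) (lam : ↥J →ₗ[F] F) (i : ℕ) :
    NonUnitalSubalgebra F R :=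
  lStep J lam (sChainAux J lam i).1 (sChainAux J lam i).2

/-- The terminal element `𝔰̄_λ` of the descending chain; the chain has stabilized by
stage `|R|` since it is a weakly decreasing chain of subalgebras of the finite algebra. -/
def sbar (J : NonUnitalSubalgebra F R) (lam : ↥J →ₗ[F] F) : NonUnitalSubalgebra F R :=
  sChain J lam (Fintype.card R)

theorem sbar_le (J : NonUnitalSubalgebra F R) (lam : ↥J →ₗ[F] F) : sbar J lam ≤ J :=
  (sChainAux J lam (Fintype.card R)).2

/-- The terminal element `𝔩̄_λ` of the ascending chain. -/
def lbar (J : NonUnitalSubalgebra F R) (lam : ↥J →ₗ[F] F) : NonUnitalSubalgebra F R :=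
  lStep J lam (sbar J lam) (sbar_le J lam)

theorem lbar_le (J : NonUnitalSubalgebra F R) (lam : ↥J →ₗ[F] F) : lbar J lam ≤ J :=
  le_trans (lStep_le J lam _ _) (sbar_le J lam)

/-! ### Algebra subgroups of an algebra group -/

/-- The algebra subgroup `1 + k` of `1 + J`, as a subgroup of the ambient algebra group. -/
def algSubgroup (k J : NonUnitalSubalgebra F R) : Subgroup ↥(algGroup F R J) :=
  (algGroup F R k).subgroupOf (algGroup F R J)

/-- `L_λ = 1 + 𝔩_λ` as a subgroup of `G`. -/
def Lgrp (J : NonUnitalSubalgebra F R) (lam : ↥J →ₗ[F] F) : Subgroup ↥(algGroup F R J) :=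
  algSubgroup (lone J lam) J

/-- `S_λ = 1 + 𝔰_λ` as a subgroup of `G`. -/
def Sgrp (J : NonUnitalSubalgebra F R) (lam : ↥J →ₗ[F] F) : Subgroup ↥(algGroup F R J) :=
  algSubgroup (sone J lam) J

/-- `L̄_λ = 1 + 𝔩̄_λ` as a subgroup of `G`. -/
def Lbarg (J : NonUnitalSubalgebra F R) (lam : ↥J →ₗ[F] F) : Subgroup ↥(algGroup F R J) :=
  algSubgroup (lbar J lam) J

/-- `S̄_λ = 1 + 𝔰̄_λ` as a subgroup of `G`. -/
def Sbarg (J : NonUnitalSubalgebra F R) (lam : ↥J →ₗ[F] F) : Subgroup ↥(algGroup F R J) :=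
  algSubgroup (sbar J lam) J

/-- Passing from an element of the subgroup `1 + k ≤ 1 + J` to an element of the
algebra group `1 + k` in its own right. -/
def toAlg {k J : NonUnitalSubalgebra F R} (x : ↥(algSubgroup k J)) : ↥(algGroup F R k) :=
  ⟨((x : ↥(algGroup F R J)) : Rˣ), Subgroup.mem_subgroupOf.mp x.2⟩

/-- The linear inclusion of a smaller subalgebra. -/
def inclMap {s J : NonUnitalSubalgebra F R} (h : s ≤ J) : ↥s →ₗ[F] ↥J where
  toFun x := ⟨(x : R), h x.2⟩
  map_add' x y := rfl
  map_smul' c x := rfl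

/-- Restriction of a functional on `J` to a smaller subalgebra. -/
def resTo {s J : NonUnitalSubalgebra F R} (h : s ≤ J) (lam : ↥J →ₗ[F] F) : ↥s →ₗ[F] F :=
  lam.comp (inclMap h)

/-- The character `ξ_λ = Ind_{L̄_λ}^G (θ_λ)`. -/
def xi (θ : AddChar F ℂ) (J : NonUnitalSubalgebra F R) (lam : ↥J →ₗ[F] F) :
    ↥(algGroup F R J) → ℂ :=
  indFun (Lbarg J lam) (fun x => thetaFn θ J lam ↑x)

/-- The set `Ξ_λ = {g λ s g⁻¹ : g ∈ G, s ∈ S̄_λ}`. -/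
def Xi (J : NonUnitalSubalgebra F R) (lam : ↥J →ₗ[F] F) : Set (↥J →ₗ[F] F) :=
  {nu | ∃ g : ↥(algGroup F R J), ∃ s ∈ Sbarg J lam, nu = coAct g (rightAct s lam)}

/-! ### Normality of algebra subgroups coming from ideals -/

theorem conj_mem_aux (s a : NonUnitalSubalgebra F R)
    (hl : ∀ x ∈ s, ∀ y ∈ a, x * y ∈ a) (hr : ∀ y ∈ a, ∀ x ∈ s, y * x ∈ a)
    (u : Rˣ) (hu1 : (u : R) - 1 ∈ s) (hu2 : ((u⁻¹ : Rˣ) : R) - 1 ∈ s)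
    (x : Rˣ) (hx : (x : R) - 1 ∈ a) : ((u * x * u⁻¹ : Rˣ) : R) - 1 ∈ a := by
  have h1 : (u : R) * ((u⁻¹ : Rˣ) : R) = 1 := Units.mul_inv u
  have key : ((u * x * u⁻¹ : Rˣ) : R) - 1 =
      ((u : R) - 1) * ((x : R) - 1) * (((u⁻¹ : Rˣ) : R) - 1) +
        ((u : R) - 1) * ((x : R) - 1) + ((x : R) - 1) * (((u⁻¹ : Rˣ) : R) - 1) +
        ((x : R) - 1) := by
    push_cast
    calc (u : R) * (x : R) * ((u⁻¹ : Rˣ) : R) - 1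
        = (u : R) * (x : R) * ((u⁻¹ : Rˣ) : R) - (u : R) * ((u⁻¹ : Rˣ) : R) := by rw [h1]
      _ = _ := by noncomm_ring
  rw [key]
  exact add_mem (add_mem (add_mem (hr _ (hl _ hu1 _ hx) _ hu2) (hl _ hu1 _ hx))
    (hr _ hx _ hu2)) hx

theorem algSubgroup_normal (s a : NonUnitalSubalgebra F R)
    (hl : ∀ x ∈ s, ∀ y ∈ a, x * y ∈ a) (hr : ∀ y ∈ a, ∀ x ∈ s, y * x ∈ a) :
    ((algGroup F R a).subgroupOf (algGroup F R s)).Normal := by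
  constructor
  intro n hn g
  rw [Subgroup.mem_subgroupOf] at hn ⊢
  have hginv : ((g⁻¹ : ↥(algGroup F R s)) : Rˣ) = ((g : Rˣ))⁻¹ := rfl
  have hcoe : ((g * n * g⁻¹ : ↥(algGroup F R s)) : Rˣ) = (g : Rˣ) * (n : Rˣ) * ((g : Rˣ))⁻¹ := by
    push_cast [hginv]; rfl
  rw [mem_algGroup]
  constructor
  · rw [hcoe]
    exact conj_mem_aux s a hl hr (g : Rˣ) (g : ↥(algGroup F R s)).2.1 (g : ↥(algGroup F R s)).2.2
      (n : Rˣ) hn.1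
  · have hinv : (((g * n * g⁻¹ : ↥(algGroup F R s)) : Rˣ))⁻¹ =
        (g : Rˣ) * ((n : Rˣ))⁻¹ * ((g : Rˣ))⁻¹ := by
      rw [hcoe]; group
    rw [hinv]
    exact conj_mem_aux s a hl hr (g : Rˣ) (g : ↥(algGroup F R s)).2.1 (g : ↥(algGroup F R s)).2.2
      ((n : Rˣ))⁻¹ hn.2

theorem lone_mul_mem (J : NonUnitalSubalgebra F R) (lam : ↥J →ₗ[F] F)
    {y z : R} (hy : y ∈ lone J lam) (hz : z ∈ J) : y * z ∈ lone J lam := by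
  refine ⟨J.mul_mem (lone_le J lam hy) hz, fun w hw => ?_⟩
  rw [mul_assoc]
  exact hy.2 (z * w) (J.mul_mem hz hw)

theorem sone_mul_lone_mem (J : NonUnitalSubalgebra F R) (lam : ↥J →ₗ[F] F)
    {x y : R} (hx : x ∈ sone J lam) (hy : y ∈ lone J lam) : x * y ∈ lone J lam := by
  refine ⟨J.mul_mem (sone_le J lam hx) (lone_le J lam hy), fun w hw => ?_⟩
  rw [mul_assoc]
  exact hx.2 (y * w) (lone_mul_mem J lam hy hw)

theorem kone_ideal_left (J : NonUnitalSubalgebra F R) (lam : ↥J →ₗ[F] F) :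
    ∀ x ∈ sone J lam, ∀ y ∈ kone J lam, x * y ∈ kone J lam := by
  intro x hx y hy
  exact ⟨sone_mul_lone_mem J lam hx hy.1, hx.2 y hy.1⟩

theorem kone_ideal_right (J : NonUnitalSubalgebra F R) (lam : ↥J →ₗ[F] F) :
    ∀ y ∈ kone J lam, ∀ x ∈ sone J lam, y * x ∈ kone J lam := by
  intro y hy x hx
  exact ⟨lone_mul_mem J lam hy.1 (sone_le J lam hx), hy.1.2 x (sone_le J lam hx)⟩

/-- `K_λ = 1 + 𝔨_λ` as a (normal) subgroup of `S_λ = 1 + 𝔰_λ`. -/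
def KgrpIn (J : NonUnitalSubalgebra F R) (lam : ↥J →ₗ[F] F) :
    Subgroup ↥(algGroup F R (sone J lam)) :=
  (algGroup F R (kone J lam)).subgroupOf (algGroup F R (sone J lam))

instance KgrpIn_normal (J : NonUnitalSubalgebra F R) (lam : ↥J →ₗ[F] F) :
    (KgrpIn J lam).Normal :=
  algSubgroup_normal (sone J lam) (kone J lam) (kone_ideal_left J lam) (kone_ideal_right J lam)

/-- `L_λ = 1 + 𝔩_λ` as a (normal) subgroup of `S_λ = 1 + 𝔰_λ`. -/
def LgrpIn (J : NonUnitalSubalgebra F R) (lam : ↥J →ₗ[F] F) :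
    Subgroup ↥(algGroup F R (sone J lam)) :=
  (algGroup F R (lone J lam)).subgroupOf (algGroup F R (sone J lam))

instance LgrpIn_normal (J : NonUnitalSubalgebra F R) (lam : ↥J →ₗ[F] F) :
    (LgrpIn J lam).Normal :=
  algSubgroup_normal (sone J lam) (lone J lam)
    (fun x hx y hy => sone_mul_lone_mem J lam hx hy)
    (fun y hy x hx => lone_mul_mem J lam hy (sone_le J lam hx))

/-! ### Character theory -/

section Characters

variable {G : Type} [Group G] [Fintype G]
  {V : Type} [AddCommGroup V] [Module ℂ V] [FiniteDimensional ℂ V]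

theorem exists_invariant_posDef {n : Type} [Fintype n] [DecidableEq n]
    (M : G →* Matrix n n ℂ) :
    ∃ P : Matrix n n ℂ, P.PosDef ∧ ∀ h, (M h).conjTranspose * P * M h = P := by
  refine ⟨∑ g : G, (M g).conjTranspose * M g, ?_, fun h => ?_⟩
  · refine Matrix.posDef_sum Finset.univ_nonempty fun g _ => ?_
    refine Matrix.PosDef.conjTranspose_mul_self _ ?_
    refine Function.LeftInverse.injective (g := (M g⁻¹).mulVec) fun v => ?_
    rw [Matrix.mulVec_mulVec, ← map_mul, inv_mul_cancel, map_one, Matrix.one_mulVec]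
  · rw [Finset.mul_sum, Finset.sum_mul]
    refine Fintype.sum_bijective (· * h) (Group.mulRight_bijective h) _ _ fun g => ?_
    rw [map_mul, Matrix.conjTranspose_mul]
    simp only [Matrix.mul_assoc]

theorem trace_inv_eq_conj (ρ : Representation ℂ G V) (g : G) :
    ρ.character g⁻¹ = (starRingEnd ℂ) (ρ.character g) := by
  let b := Module.finBasis ℂ V
  let M : G →* Matrix _ _ ℂ :=
    (MonoidHomClass.toMonoidHom (LinearMap.toMatrixAlgEquiv b)).comp ρ
  have hM (h : G) : ρ.character h = (M h).trace := LinearMap.trace_eq_matrix_trace ℂ b (ρ h)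
  obtain ⟨P, hP, hinv⟩ := exists_invariant_posDef M
  have hPdet := (Matrix.isUnit_iff_isUnit_det _).1 hP.isUnit
  have key : (M g).conjTranspose = P * M g⁻¹ * P⁻¹ := by
    have h1 : M g * M g⁻¹ = 1 := by rw [← map_mul, mul_inv_cancel, map_one]
    calc (M g).conjTranspose
        = (M g).conjTranspose * P * (M g * M g⁻¹) * P⁻¹ := by
          rw [h1, mul_one, Matrix.mul_nonsing_inv_cancel_right _ _ hPdet]
      _ = _ := by rw [← mul_assoc, hinv g]
  rw [hM, hM, starRingEnd_apply, ← Matrix.trace_conjTranspose, key, Matrix.mul_assoc,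
    Matrix.trace_mul_comm, Matrix.mul_assoc, Matrix.nonsing_inv_mul _ hPdet, mul_one]

theorem innerG_eq_sum (f h : G → ℂ) :
    innerG G f h = (Nat.card G : ℂ)⁻¹ * ∑ x : G, f x * (starRingEnd ℂ) (h x) := by
  rw [innerG, finsum_eq_sum_of_fintype]

/-- Schur's lemma for a representation whose character has norm one. -/
theorem exists_smul_of_commute (ρ : Representation ℂ G V)
    (hρ : innerG G ρ.character ρ.character = 1)
    (T : V →ₗ[ℂ] V) (hT : ∀ g, T * ρ g = ρ g * T) : ∃ c : ℂ, T = c • 1 := by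
  have : Invertible (Nat.card G : ℂ) :=
    invertibleOfNonzero (Nat.cast_ne_zero.2 Nat.card_pos.ne')
  have h1 : Module.finrank ℂ (Representation.IntertwiningMap ρ ρ) = 1 := by
    have := Representation.card_inv_mul_sum_char_mul_char_eq_finrank ρ ρ
    simp_rw [trace_inv_eq_conj] at this
    rw [← innerG_eq_sum, hρ] at this
    exact_mod_cast this.symm
  by_cases hid : (Representation.IntertwiningMap.id ρ) = 0
  · refine ⟨0, LinearMap.ext fun v => ?_⟩
    have hz : ∀ w : V, w = 0 := fun w => congr($hid w)
    rw [hz v]; simp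
  · obtain ⟨c, hc⟩ := (finrank_eq_one_iff_of_nonzero' _ hid).1 h1
      ⟨T, fun g => hT g⟩
    exact ⟨c, LinearMap.ext fun v => (congr($hc v)).symm⟩

theorem trace_eq_zero_or_of_mul_eq_zero (ρ : Representation ℂ G V)
    (hρ : innerG G ρ.character ρ.character = 1)
    (E E' : V →ₗ[ℂ] V) (hE : ∀ x, E * ρ x * E' = 0) :
    LinearMap.trace ℂ V E = 0 ∨ LinearMap.trace ℂ V E' = 0 := by
  obtain ⟨c, hc⟩ := exists_smul_of_commute ρ hρ (∑ g, ρ g * E' * ρ g⁻¹) fun h => by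
    rw [Finset.sum_mul, Finset.mul_sum]
    refine (Fintype.sum_bijective (h * ·) (Group.mulLeft_bijective h) _ _ fun g => ?_).symm
    rw [mul_inv_rev, map_mul, map_mul]
    have : ρ h⁻¹ * ρ h = 1 := by rw [← map_mul, inv_mul_cancel, map_one]
    simp only [mul_assoc, this, mul_one]
  have h0 : c • E = 0 := by
    calc c • E = E * (c • 1) := by rw [mul_smul_comm, mul_one]
      _ = 0 := by
        rw [← hc, Finset.mul_sum]
        refine Finset.sum_eq_zero fun g _ => ?_
        rw [← mul_assoc, ← mul_assoc, hE, zero_mul]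
  rcases smul_eq_zero.1 h0 with rfl | h
  · right
    have ht := congr(LinearMap.trace ℂ V $hc)
    have : ∀ g, LinearMap.trace ℂ V (ρ g * E' * ρ g⁻¹) = LinearMap.trace ℂ V E' := fun g => by
      rw [LinearMap.trace_mul_comm, ← mul_assoc, ← map_mul, inv_mul_cancel, map_one, one_mul]
    rw [map_sum, zero_smul, map_zero] at ht
    simp_rw [this] at ht
    rw [Finset.sum_const, Finset.card_univ, nsmul_eq_mul] at ht
    exact (mul_eq_zero.1 ht).resolve_left (Nat.cast_ne_zero.2 Fintype.card_ne_zero)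
  · left; rw [h, map_zero]

/-- The operator `∑_{l ∈ H} φ(l)⁻¹ ρ(l)`, a multiple of the projection onto the `φ`-isotypic
part of `ρ|_H`. -/
def twistedSum (ρ : Representation ℂ G V) {H : Subgroup G} (φ : ↥H →* ℂ) : V →ₗ[ℂ] V :=
  ∑ l : ↥H, φ l⁻¹ • ρ (l : G)

theorem twistedSum_mul (ρ : Representation ℂ G V) {H : Subgroup G} (φ : ↥H →* ℂ) (h : ↥H) :
    twistedSum ρ φ * ρ (h : G) = φ h • twistedSum ρ φ := by
  rw [twistedSum, Finset.sum_mul, Finset.smul_sum]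
  refine Fintype.sum_bijective (· * h) (Group.mulRight_bijective h) _ _ fun l => ?_
  rw [smul_smul, ← map_mul, mul_inv_rev, mul_inv_cancel_left, smul_mul_assoc, ← map_mul,
    Subgroup.coe_mul]

theorem mul_twistedSum (ρ : Representation ℂ G V) {H : Subgroup G} (φ : ↥H →* ℂ) (h : ↥H) :
    ρ (h : G) * twistedSum ρ φ = φ h • twistedSum ρ φ := by
  rw [twistedSum, Finset.mul_sum, Finset.smul_sum]
  refine Fintype.sum_bijective (h * ·) (Group.mulLeft_bijective h) _ _ fun l => ?_
  rw [smul_smul, ← map_mul, mul_inv_rev, mul_smul_comm, ← map_mul, Subgroup.coe_mul,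
    map_mul φ h, map_mul φ l⁻¹, mul_left_comm, ← map_mul φ h, mul_inv_cancel, map_one, mul_one]

theorem twistedSum_mul_mul_twistedSum_eq_zero (ρ : Representation ℂ G V) {H H' : Subgroup G}
    (φ : ↥H →* ℂ) (φ' : ↥H' →* ℂ) (x : G) (l : ↥H) (l' : ↥H') (hx : (l : G) * x = x * l')
    (hne : φ l ≠ φ' l') : twistedSum ρ φ * ρ x * twistedSum ρ φ' = 0 := by
  have h1 : twistedSum ρ φ * ρ ((l : G) * x) * twistedSum ρ φ' =
      φ l • (twistedSum ρ φ * ρ x * twistedSum ρ φ') := by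
    rw [map_mul, ← mul_assoc, twistedSum_mul, smul_mul_assoc, smul_mul_assoc]
  have h2 : twistedSum ρ φ * ρ ((l : G) * x) * twistedSum ρ φ' =
      φ' l' • (twistedSum ρ φ * ρ x * twistedSum ρ φ') := by
    rw [hx, map_mul, ← mul_assoc, mul_assoc _ (ρ (l' : G)), mul_twistedSum, mul_smul_comm]
  have h3 := h1.symm.trans h2
  rw [← sub_eq_zero, ← sub_smul] at h3
  exact (smul_eq_zero.1 h3).resolve_left (sub_ne_zero.2 hne)

theorem indFun_eq_sum (H : Subgroup G) (ψ : ↥H → ℂ) (g : G) :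
    indFun H ψ g = (Nat.card ↥H : ℂ)⁻¹ *
      ∑ x : G, if h : x * g * x⁻¹ ∈ H then ψ ⟨x * g * x⁻¹, h⟩ else 0 := by
  rw [indFun, finsum_eq_sum_of_fintype]

theorem sum_dite_mem (H : Subgroup G) (f : ↥H → ℂ) :
    ∑ x : G, (if h : x ∈ H then f ⟨x, h⟩ else 0) = ∑ l : ↥H, f l := by
  rw [← Finset.sum_subset (Finset.subset_univ (Finset.univ.filter (· ∈ H)))
    fun x _ hx => dif_neg (by simpa using hx)]
  rw [Finset.sum_subtype (p := (· ∈ H)) _ (by simp)]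
  exact Finset.sum_congr rfl fun l _ => dif_pos l.2

/-- Frobenius reciprocity for class functions. -/
theorem innerG_indFun (H : Subgroup G) (ψ : ↥H → ℂ) (f : G → ℂ)
    (hf : ∀ x g, f (x * g * x⁻¹) = f g) :
    innerG G (indFun H ψ) f =
      (Nat.card ↥H : ℂ)⁻¹ * ∑ l : ↥H, ψ l * (starRingEnd ℂ) (f l) := by
  have hG : (Nat.card G : ℂ) ≠ 0 := Nat.cast_ne_zero.2 Nat.card_pos.ne'
  rw [innerG_eq_sum]
  simp_rw [indFun_eq_sum, mul_assoc, ← Finset.mul_sum, Finset.sum_mul]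
  rw [Finset.sum_comm]
  have h1 (x : G) : ∑ g : G, (if h : x * (g * x⁻¹) ∈ H then ψ ⟨x * (g * x⁻¹), h⟩ else 0) *
      (starRingEnd ℂ) (f g) = ∑ l : ↥H, ψ l * (starRingEnd ℂ) (f l) := by
    rw [← sum_dite_mem H fun l => ψ l * (starRingEnd ℂ) (f l)]
    refine Fintype.sum_bijective (fun g => x * g * x⁻¹) (MulAut.conj x).bijective _ _ fun g => ?_
    simp only [hf, ← mul_assoc]
    split_ifs <;> simp
  simp_rw [h1]
  rw [Finset.sum_const, Finset.card_univ, nsmul_eq_mul, ← Nat.card_eq_fintype_card]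
  field_simp

theorem trace_twistedSum_ne_zero (ρ : Representation ℂ G V) {H : Subgroup G} (φ : ↥H →* ℂ)
    (hφ : ∀ l, φ l⁻¹ = (starRingEnd ℂ) (φ l))
    (h : innerG G (indFun H φ) ρ.character ≠ 0) :
    LinearMap.trace ℂ V (twistedSum ρ φ) ≠ 0 := by
  intro h0
  refine h ?_
  rw [innerG_indFun H φ _ fun x g => ρ.char_conj g x]
  have : (starRingEnd ℂ) (LinearMap.trace ℂ V (twistedSum ρ φ)) =
      ∑ l : ↥H, φ l * (starRingEnd ℂ) (ρ.character (l : G)) := by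
    rw [twistedSum, map_sum, map_sum]
    refine Finset.sum_congr rfl fun l _ => ?_
    rw [map_smul, smul_eq_mul, map_mul, hφ, Complex.conj_conj]
    rfl
  rw [← this, h0, map_zero, mul_zero]

end Characters

/-! ### Linear functionals and algebra subgroups -/

section Functionals

variable {J : NonUnitalSubalgebra F R}

theorem lamE_coe (lam : ↥J →ₗ[F] F) (X : ↥J) : lamE J lam (X : R) = lam X :=
  lamE_apply J lam X.2

theorem lamE_sub_left (lam mu : ↥J →ₗ[F] F) (x : R) :
    lamE J (lam - mu) x = lamE J lam x - lamE J mu x := by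
  unfold lamE
  split_ifs <;> simp

theorem lamE_ext {lam mu : ↥J →ₗ[F] F} (h : ∀ x ∈ J, lamE J lam x = lamE J mu x) : lam = mu :=
  LinearMap.ext fun X => by rw [← lamE_coe, ← lamE_coe, h _ X.2]

theorem lamE_coAct (g : ↥(algGroup F R J)) (lam : ↥J →ₗ[F] F) {x : R} (hx : x ∈ J) :
    lamE J (coAct g lam) x = lamE J lam ((g : Rˣ) * x * ((g : Rˣ)⁻¹ : Rˣ)) := by
  rw [lamE_apply J _ hx, mul_assoc]
  exact (lamE_coe lam (lmulMap g (rmulMap g⁻¹ ⟨x, hx⟩))).symm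

theorem lamE_rightAct (g : ↥(algGroup F R J)) (lam : ↥J →ₗ[F] F) {x : R} (hx : x ∈ J) :
    lamE J (rightAct g lam) x = lamE J lam (x * ((g : Rˣ)⁻¹ : Rˣ)) := by
  rw [lamE_apply J _ hx]
  exact (lamE_coe lam (rmulMap g⁻¹ ⟨x, hx⟩)).symm

theorem coAct_coAct (g h : ↥(algGroup F R J)) (lam : ↥J →ₗ[F] F) :
    coAct g (coAct h lam) = coAct (h * g) lam := by
  refine LinearMap.ext fun X => congrArg lam (Subtype.ext ?_)
  simp [lmulMap, rmulMap, mul_assoc]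

theorem coAct_one (lam : ↥J →ₗ[F] F) : coAct 1 lam = lam := by
  refine LinearMap.ext fun X => congrArg lam (Subtype.ext ?_)
  simp [lmulMap, rmulMap]

theorem coAct_inv_coAct (g : ↥(algGroup F R J)) (lam : ↥J →ₗ[F] F) :
    coAct g⁻¹ (coAct g lam) = lam := by
  rw [coAct_coAct, mul_inv_cancel, coAct_one]

theorem coAct_coAct_inv (g : ↥(algGroup F R J)) (lam : ↥J →ₗ[F] F) :
    coAct g (coAct g⁻¹ lam) = lam := by
  rw [coAct_coAct, inv_mul_cancel, coAct_one]

theorem unit_mul_mem {s t : NonUnitalSubalgebra F R} (h : ∀ a ∈ s, ∀ x ∈ t, a * x ∈ t)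
    {u x : R} (hu : u - 1 ∈ s) (hx : x ∈ t) : u * x ∈ t := by
  have : u * x = (u - 1) * x + x := by noncomm_ring
  rw [this]
  exact add_mem (h _ hu _ hx) hx

theorem mul_unit_mem {s t : NonUnitalSubalgebra F R} (h : ∀ x ∈ t, ∀ a ∈ s, x * a ∈ t)
    {u x : R} (hu : u - 1 ∈ s) (hx : x ∈ t) : x * u ∈ t := by
  have : x * u = x * (u - 1) + x := by noncomm_ring
  rw [this]
  exact add_mem (h _ hx _ hu) hx

theorem mul_sub_one_add_self (x u : R) : x * (u - 1) + x = x * u := by noncomm_ring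

theorem sub_one_mul_add_self (x u : R) : (u - 1) * x + x = u * x := by noncomm_ring

theorem IsNil.exists_pow_eq_zero (hJ : IsNil J) {x : R} (hx : x ∈ J) : ∃ n : ℕ, x ^ n = 0 := by
  obtain ⟨N, hN⟩ := hJ
  refine ⟨N, ?_⟩
  rw [← List.prod_replicate]
  exact hN _ (fun y hy => by rwa [List.eq_of_mem_replicate hy]) List.length_replicate

theorem pow_succ_mem {s : NonUnitalSubalgebra F R} {x : R} (hx : x ∈ s) (n : ℕ) :
    x ^ (n + 1) ∈ s := by
  induction n with
  | zero => simpa using hx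
  | succ n ih => rw [pow_succ]; exact mul_mem ih hx

theorem exists_mem_algSubgroup (hJ : IsNil J) {s : NonUnitalSubalgebra F R} (hs : s ≤ J)
    {x : R} (hx : x ∈ s) : ∃ g ∈ algSubgroup s J, ((g : Rˣ) : R) = 1 + x := by
  have hnx : -x ∈ s := neg_mem hx
  obtain ⟨n, hn⟩ := hJ.exists_pow_eq_zero (hs hnx)
  let y := ∑ i ∈ Finset.range (n + 1), (-x) ^ i
  have hn' : (-x) ^ (n + 1) = 0 := by rw [pow_succ, hn, zero_mul]
  have h1 : (1 + x) * y = 1 := by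
    have := mul_neg_geom_sum (-x) (n + 1)
    rwa [hn', sub_neg_eq_add, sub_zero] at this
  have h2 : y * (1 + x) = 1 := by
    have := geom_sum_mul_neg (-x) (n + 1)
    rwa [hn', sub_neg_eq_add, sub_zero] at this
  have hy : y - 1 ∈ s := by
    have : y - 1 = ∑ i ∈ Finset.range n, (-x) ^ (i + 1) := by
      simp only [y, Finset.sum_range_succ', pow_zero, add_sub_cancel_right]
    rw [this]
    exact sum_mem fun i _ => pow_succ_mem hnx i
  have hu : (1 + x) - 1 ∈ s := by rwa [add_sub_cancel_left]
  exact ⟨⟨⟨1 + x, y, h1, h2⟩, hs hu, hs hy⟩, ⟨hu, hy⟩, rfl⟩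

theorem mem_algSubgroup_iff (hJ : IsNil J) {s : NonUnitalSubalgebra F R} (hs : s ≤ J)
    {g : ↥(algGroup F R J)} : g ∈ algSubgroup s J ↔ ((g : Rˣ) : R) - 1 ∈ s := by
  refine ⟨fun h => h.1, fun h => ?_⟩
  obtain ⟨g', hg', he⟩ := exists_mem_algSubgroup hJ hs h
  rw [add_sub_cancel] at he
  rwa [← Subtype.ext (Units.ext he)]

/-- A functional vanishing on the left kernel of `(x, y) ↦ λ(xy)` on `s × t` is of the form
`x ↦ λ(xy)` on `s`, for some `y ∈ t`. -/
theorem exists_lamE_mul_eq (lam mu : ↥J →ₗ[F] F) {s t : NonUnitalSubalgebra F R}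
    (hs : s ≤ J) (ht : t ≤ J)
    (h : ∀ x ∈ s, (∀ y ∈ t, lamE J lam (x * y) = 0) → lamE J mu x = 0) :
    ∃ y ∈ t, ∀ x ∈ s, lamE J mu x = lamE J lam (x * y) := by
  let B : ↥t →ₗ[F] Module.Dual F ↥s :=
    LinearMap.mk₂ F (fun y x => lamE J lam ((x : R) * y))
      (fun y y' x => by
        rw [NonUnitalSubalgebra.coe_add, mul_add,
          lamE_add J lam (mul_mem (hs x.2) (ht y.2)) (mul_mem (hs x.2) (ht y'.2))])
      (fun c y x => by
        rw [NonUnitalSubalgebra.coe_smul, mul_smul_comm,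
          lamE_smul J lam c (mul_mem (hs x.2) (ht y.2)), smul_eq_mul])
      (fun y x x' => by
        rw [NonUnitalSubalgebra.coe_add, add_mul,
          lamE_add J lam (mul_mem (hs x.2) (ht y.2)) (mul_mem (hs x'.2) (ht y.2))])
      (fun c y x => by
        rw [NonUnitalSubalgebra.coe_smul, smul_mul_assoc,
          lamE_smul J lam c (mul_mem (hs x.2) (ht y.2)), smul_eq_mul])
  have hmem : (resTo hs mu : Module.Dual F ↥s) ∈ LinearMap.range B := by
    rw [← Subspace.dualCoannihilator_dualAnnihilator_eq (W := LinearMap.range B),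
      Submodule.mem_dualAnnihilator]
    intro x hx
    rw [Submodule.mem_dualCoannihilator] at hx
    refine (lamE_apply J mu (hs x.2)).symm.trans (h x x.2 fun y hy => ?_)
    exact hx _ ⟨⟨y, hy⟩, rfl⟩
  obtain ⟨y, hy⟩ := hmem
  exact ⟨y, y.2, fun x hx => (lamE_apply J mu (hs hx)).trans
    (LinearMap.congr_fun hy ⟨x, hx⟩).symm⟩

end Functionals

/-! ### The chains of subalgebras attached to a functional -/

section Chains

variable {J : NonUnitalSubalgebra F R} (lam : ↥J →ₗ[F] F)

theorem sChain_le (i : ℕ) : sChain J lam i ≤ J := (sChainAux J lam i).2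

theorem mem_sChain_succ {i : ℕ} {x : R} : x ∈ sChain J lam (i + 1) ↔
    x ∈ sChain J lam i ∧ ∀ y ∈ lChain J lam i, lamE J lam (x * y) = 0 := Iff.rfl

theorem mem_lChain {i : ℕ} {x : R} : x ∈ lChain J lam i ↔
    x ∈ sChain J lam i ∧ ∀ y ∈ sChain J lam i, lamE J lam (x * y) = 0 := Iff.rfl

theorem lChain_le (i : ℕ) : lChain J lam i ≤ J := fun _ hx => sChain_le lam i hx.1

theorem lChain_mul_mem {i : ℕ} {y z : R} (hy : y ∈ lChain J lam i) (hz : z ∈ sChain J lam i) :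
    y * z ∈ lChain J lam i := by
  refine ⟨mul_mem hy.1 hz, fun w hw => ?_⟩
  rw [mul_assoc]
  exact hy.2 (z * w) (mul_mem hz hw)

theorem sChain_antitone : Antitone (sChain J lam) :=
  antitone_nat_of_succ_le fun _ _ hx => hx.1

theorem lChain_monotone : Monotone (lChain J lam) := by
  refine monotone_nat_of_le_succ fun i x hx => ⟨⟨hx.1, fun y hy => hx.2 y hy.1⟩, fun y hy => ?_⟩
  exact hx.2 y (sChain_antitone lam i.le_succ hy)

theorem sChain_stabilizes (n : ℕ) :
    sChain J lam (n + 1) = sChain J lam n ∨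
      Nat.card ↥(sChain J lam n) + n ≤ Fintype.card R := by
  induction n with
  | zero =>
    right
    rw [add_zero, ← Nat.card_eq_fintype_card]
    exact Nat.card_le_card_of_injective _ Subtype.val_injective
  | succ n ih =>
    by_cases h : sChain J lam (n + 1) = sChain J lam n
    · left
      have hl : lChain J lam (n + 1) = lChain J lam n := by
        ext x; rw [mem_lChain, mem_lChain, h]
      ext x
      refine (mem_sChain_succ lam).trans (Iff.trans ?_ (mem_sChain_succ lam).symm)
      rw [hl, h]
    · right
      have h1 := ih.resolve_left h
      have hlt : (sChain J lam (n + 1) : Set R) ⊂ sChain J lam n :=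
        (sChain_antitone lam n.le_succ).lt_of_ne h
      have := Set.ncard_lt_ncard hlt
      change Nat.card ↥(sChain J lam (n + 1)) < Nat.card ↥(sChain J lam n) at this
      omega

theorem lamE_sbar_mul_lbar {x y : R} (hx : x ∈ sbar J lam) (hy : y ∈ lbar J lam) :
    lamE J lam (x * y) = 0 := by
  have h : sChain J lam (Fintype.card R + 1) = sChain J lam (Fintype.card R) := by
    refine (sChain_stabilizes lam _).resolve_right fun h => ?_
    have : 0 < Nat.card ↥(sChain J lam (Fintype.card R)) := Nat.card_pos
    omega
  have hx' : x ∈ sChain J lam (Fintype.card R + 1) := by rw [h]; exact hx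
  exact hx'.2 y hy

theorem lamE_lbar_mul_unit {x u : R} (hx : x ∈ lbar J lam) (hu : u - 1 ∈ sbar J lam) :
    lamE J lam (x * u) = lamE J lam x := by
  rw [← mul_sub_one_add_self, lamE_add J lam (mul_mem (lbar_le J lam hx) (sbar_le J lam hu))
    (lbar_le J lam hx), hx.2 _ hu, zero_add]

theorem lbar_mul_unit_mem {x u : R} (hx : x ∈ lbar J lam) (hu : u - 1 ∈ sbar J lam) :
    x * u ∈ lbar J lam :=
  mul_unit_mem (fun _ hx _ hu => lChain_mul_mem lam hx hu) hu hx

/-- The set of functionals which agree with `λ` on `𝔩̄_λ`. -/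
def agreeSet : Set (↥J →ₗ[F] F) :=
  {mu | ∀ x ∈ lbar J lam, lamE J mu x = lamE J lam x}

theorem mem_agreeSet {mu : ↥J →ₗ[F] F} :
    mu ∈ agreeSet lam ↔ ∀ x ∈ lbar J lam, lamE J mu x = lamE J lam x := Iff.rfl

theorem coAct_mem_agreeSet_iff (hJ : IsNil J) {g : ↥(algGroup F R J)} :
    coAct g lam ∈ agreeSet lam ↔ g ∈ Sbarg J lam := by
  constructor
  · intro h
    have key : ∀ i ≤ Fintype.card R, ((g : Rˣ) : R) - 1 ∈ sChain J lam i := by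
      intro i
      induction i with
      | zero => exact fun _ => g.2.1
      | succ i ih =>
        intro hi
        have hg := ih (by omega)
        refine ⟨hg, fun y hy => ?_⟩
        have hyJ := lChain_le lam i hy
        have hyg : y * ((g : Rˣ) : R) ∈ lChain J lam i :=
          mul_unit_mem (fun _ hx _ hu => lChain_mul_mem lam hx hu) hg hy
        have h1 := h _ (lChain_monotone lam (by omega : i ≤ Fintype.card R) hyg)
        rw [lamE_coAct g lam (lChain_le lam i hyg), mul_assoc, mul_assoc, Units.mul_inv, mul_one,
          ← mul_sub_one_add_self y ((g : Rˣ) : R),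
          lamE_add J lam (lChain_le lam i (lChain_mul_mem lam hy hg)) hyJ,
          hy.2 _ hg, zero_add, ← sub_one_mul_add_self y ((g : Rˣ) : R),
          lamE_add J lam (mul_mem g.2.1 hyJ) hyJ] at h1
        exact add_eq_right.1 h1
    exact (mem_algSubgroup_iff hJ (sbar_le J lam)).2 (key _ le_rfl)
  · intro hg x hx
    have hinv : (((g : Rˣ)⁻¹ : Rˣ) : R) - 1 ∈ sbar J lam := hg.2
    have hg1 : ((g : Rˣ) : R) - 1 ∈ sbar J lam := hg.1
    have hz := lbar_mul_unit_mem lam hx hinv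
    rw [lamE_coAct g lam (lbar_le J lam hx), mul_assoc, ← sub_one_mul_add_self,
      lamE_add J lam (mul_mem g.2.1 (lbar_le J lam hz)) (lbar_le J lam hz),
      lamE_sbar_mul_lbar lam hg1 hz, zero_add]
    exact lamE_lbar_mul_unit lam hx hinv

/-- A functional agreeing with `λ` on some `𝔰_λ^i` lies in the coadjoint orbit of `λ`. -/
theorem exists_coAct_eq_of_agree_sChain (hJ : IsNil J) (i : ℕ) (mu : ↥J →ₗ[F] F)
    (h : ∀ x ∈ sChain J lam i, lamE J mu x = lamE J lam x) : ∃ g, coAct g mu = lam := by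
  induction i generalizing mu with
  | zero => exact ⟨1, by rw [coAct_one]; exact lamE_ext h⟩
  | succ i ih =>
    obtain ⟨y, hy, hxy⟩ := exists_lamE_mul_eq lam (mu - lam) (sChain_le lam i) (lChain_le lam i)
      fun x hx hxl => by rw [lamE_sub_left, h x ⟨hx, hxl⟩, sub_self]
    obtain ⟨l, hl, hly⟩ := exists_mem_algSubgroup hJ (lChain_le lam i) hy
    have hl1 : ((l : Rˣ) : R) - 1 ∈ lChain J lam i := hl.1
    have hl2 : (((l : Rˣ)⁻¹ : Rˣ) : R) - 1 ∈ lChain J lam i := hl.2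
    have key : ∀ x ∈ sChain J lam i,
        lamE J mu x = lamE J lam (((l : Rˣ)⁻¹ : Rˣ) * (x * (l : Rˣ))) := fun x hx => by
      have hxl : x * ((l : Rˣ) : R) ∈ sChain J lam i :=
        mul_unit_mem (fun _ ha _ hb => mul_mem ha hb) hl1.1 hx
      have hxJ := sChain_le lam i hx
      rw [← sub_one_mul_add_self, lamE_add J lam (mul_mem l.2.2 (sChain_le lam i hxl))
        (sChain_le lam i hxl), hl2.2 _ hxl, zero_add, hly, mul_add, mul_one,
        lamE_add J lam hxJ (mul_mem hxJ (lChain_le lam i hy)), ← hxy x hx, lamE_sub_left]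
      ring
    obtain ⟨g, hg⟩ := ih (coAct l mu) fun x hx => by
      have hx' : ((l : Rˣ) : R) * x * ((l : Rˣ)⁻¹ : Rˣ) ∈ sChain J lam i :=
        mul_unit_mem (fun _ ha _ hb => mul_mem ha hb) hl2.1
          (unit_mul_mem (fun _ ha _ hb => mul_mem ha hb) hl1.1 hx)
      rw [lamE_coAct l mu (sChain_le lam i hx), key _ hx', mul_assoc _ _ ((l : Rˣ) : R),
        Units.inv_mul, mul_one, ← mul_assoc, Units.inv_mul, one_mul]
    exact ⟨l * g, by rw [← coAct_coAct, hg]⟩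

theorem mem_lChain_rightAct {s : ↥(algGroup F R J)} {i : ℕ}
    (hs : s ∈ algSubgroup (sChain J lam i) J)
    (ih : ∀ x, x ∈ sChain J (rightAct s lam) i ↔ x ∈ sChain J lam i) (x : R) :
    x ∈ lChain J (rightAct s lam) i ↔ x ∈ lChain J lam i := by
  simp only [mem_lChain, ih]
  refine and_congr_right fun hx => ⟨fun h y hy => ?_, fun h y hy => ?_⟩
  · have hys : y * ((s : Rˣ) : R) ∈ sChain J lam i :=
      mul_unit_mem (fun _ ha _ hb => mul_mem ha hb) hs.1 hy
    have := h _ hys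
    rwa [lamE_rightAct s lam (sChain_le lam i (mul_mem hx hys)), mul_assoc, mul_assoc,
      Units.mul_inv, mul_one] at this
  · rw [lamE_rightAct s lam (sChain_le lam i (mul_mem hx hy)), mul_assoc]
    exact h _ (mul_unit_mem (fun _ ha _ hb => mul_mem ha hb) hs.2 hy)

theorem mem_sChain_rightAct {s : ↥(algGroup F R J)} (i : ℕ)
    (hs : s ∈ algSubgroup (sChain J lam i) J) (x : R) :
    x ∈ sChain J (rightAct s lam) i ↔ x ∈ sChain J lam i := by
  induction i generalizing x with
  | zero => exact Iff.rfl
  | succ i ih =>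
    have hs' : s ∈ algSubgroup (sChain J lam i) J := ⟨hs.1.1, hs.2.1⟩
    simp only [mem_sChain_succ, mem_lChain_rightAct lam hs' (ih hs'), ih hs']
    refine and_congr_right fun hx => ⟨fun h y hy => ?_, fun h y hy => ?_⟩
    · have hys : y * ((s : Rˣ) : R) ∈ lChain J lam i :=
        mul_unit_mem (fun _ ha _ hb => lChain_mul_mem lam ha hb) hs'.1 hy
      have := h _ hys
      rwa [lamE_rightAct s lam (mul_mem (sChain_le lam i hx) (lChain_le lam i hys)), mul_assoc,
        mul_assoc, Units.mul_inv, mul_one] at this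
    · rw [lamE_rightAct s lam (mul_mem (sChain_le lam i hx) (lChain_le lam i hy)), mul_assoc]
      exact h _ (mul_unit_mem (fun _ ha _ hb => lChain_mul_mem lam ha hb) hs'.2 hy)

theorem lamE_rightAct_of_mem_lbar {s : ↥(algGroup F R J)} (hs : s ∈ Sbarg J lam) {x : R}
    (hx : x ∈ lbar J lam) : lamE J (rightAct s lam) x = lamE J lam x := by
  rw [lamE_rightAct s lam (lbar_le J lam hx)]
  exact lamE_lbar_mul_unit lam hx hs.2

theorem agreeSet_rightAct {s : ↥(algGroup F R J)} (hs : s ∈ Sbarg J lam) :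
    agreeSet (rightAct s lam) = agreeSet lam := by
  ext mu
  have h : ∀ x, x ∈ lbar J (rightAct s lam) ↔ x ∈ lbar J lam :=
    mem_lChain_rightAct lam hs (mem_sChain_rightAct lam _ hs)
  simp only [mem_agreeSet, h]
  exact forall₂_congr fun x hx => by rw [lamE_rightAct_of_mem_lbar lam hs hx]

theorem mem_lChain_of_mulEquiv {lam lam' : ↥J →ₗ[F] F} (φ : R ≃* R)
    (hφ : ∀ x, φ x ∈ J ↔ x ∈ J) (h : ∀ x ∈ J, lamE J lam' x = lamE J lam (φ x)) {i : ℕ}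
    (ih : ∀ x, x ∈ sChain J lam' i ↔ φ x ∈ sChain J lam i) (x : R) :
    x ∈ lChain J lam' i ↔ φ x ∈ lChain J lam i := by
  rw [mem_lChain, mem_lChain, ih]
  refine and_congr_right fun hx => ?_
  refine Iff.trans (forall_congr' fun y => ?_) (φ.surjective.forall
    (p := fun y => y ∈ sChain J lam i → lamE J lam (φ x * y) = 0)).symm
  rw [ih]
  refine forall_congr' fun hy => ?_
  rw [← map_mul, h]
  exact (hφ _).1 (by rw [map_mul]; exact sChain_le lam i (mul_mem hx hy))

theorem mem_sChain_of_mulEquiv {lam lam' : ↥J →ₗ[F] F} (φ : R ≃* R)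
    (hφ : ∀ x, φ x ∈ J ↔ x ∈ J) (h : ∀ x ∈ J, lamE J lam' x = lamE J lam (φ x)) (i : ℕ) (x : R) :
    x ∈ sChain J lam' i ↔ φ x ∈ sChain J lam i := by
  induction i generalizing x with
  | zero => exact (hφ x).symm
  | succ i ih =>
    rw [mem_sChain_succ, mem_sChain_succ, ih]
    refine and_congr_right fun hx => ?_
    refine Iff.trans (forall_congr' fun y => ?_) (φ.surjective.forall
      (p := fun y => y ∈ lChain J lam i → lamE J lam (φ x * y) = 0)).symm
    rw [mem_lChain_of_mulEquiv φ hφ h ih]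
    refine forall_congr' fun hy => ?_
    rw [← map_mul, h]
    exact (hφ _).1 (by rw [map_mul]; exact mul_mem (sChain_le lam i hx) (lChain_le lam i hy))

/-- Conjugation by a unit. -/
def unitConj (u : Rˣ) : R ≃* R where
  toFun x := u * x * (u⁻¹ : Rˣ)
  invFun x := (u⁻¹ : Rˣ) * x * u
  left_inv x := by simp [mul_assoc]
  right_inv x := by simp [mul_assoc]
  map_mul' x y := by simp [mul_assoc]

theorem unitConj_apply (u : Rˣ) (x : R) : unitConj u x = u * x * (u⁻¹ : Rˣ) := rfl

theorem unitConj_mem {g : Rˣ} (hg : g ∈ algGroup F R J) {x : R} (hx : x ∈ J) :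
    unitConj g x ∈ J :=
  mul_unit_mem (fun _ ha _ hb => mul_mem ha hb) hg.2
    (unit_mul_mem (fun _ ha _ hb => mul_mem ha hb) hg.1 hx)

theorem unitConj_mem_iff {g : Rˣ} (hg : g ∈ algGroup F R J) (x : R) :
    unitConj g x ∈ J ↔ x ∈ J := by
  refine ⟨fun h => ?_, unitConj_mem hg⟩
  have := unitConj_mem (inv_mem hg) h
  simpa [unitConj_apply, mul_assoc] using this

theorem lamE_coAct_eq_unitConj (g : ↥(algGroup F R J)) {x : R} (hx : x ∈ J) :
    lamE J (coAct g lam) x = lamE J lam (unitConj (g : Rˣ) x) :=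
  lamE_coAct g lam hx

theorem mem_lbar_coAct (g : ↥(algGroup F R J)) (x : R) :
    x ∈ lbar J (coAct g lam) ↔ unitConj (g : Rˣ) x ∈ lbar J lam :=
  mem_lChain_of_mulEquiv _ (unitConj_mem_iff g.2) (fun _ => lamE_coAct_eq_unitConj lam g)
    (mem_sChain_of_mulEquiv _ (unitConj_mem_iff g.2) (fun _ => lamE_coAct_eq_unitConj lam g) _) x

theorem mem_agreeSet_coAct (g : ↥(algGroup F R J)) {mu : ↥J →ₗ[F] F} :
    mu ∈ agreeSet (coAct g lam) ↔ coAct g⁻¹ mu ∈ agreeSet lam := by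
  have hφ := unitConj_mem_iff g.2
  refine Iff.trans (forall_congr' fun x => ?_) ((unitConj (g : Rˣ)).surjective.forall
    (p := fun x => x ∈ lbar J lam → lamE J (coAct g⁻¹ mu) x = lamE J lam x)).symm
  rw [mem_lbar_coAct]
  refine forall_congr' fun hx => ?_
  have hxJ := lbar_le J lam hx
  rw [lamE_coAct_eq_unitConj lam g ((hφ x).1 hxJ), ← coAct_coAct_inv g mu,
    lamE_coAct g _ ((hφ x).1 hxJ), ← unitConj_apply, coAct_coAct_inv]

theorem exists_coAct_eq_rightAct (hJ : IsNil J) {mu : ↥J →ₗ[F] F} (hmu : mu ∈ agreeSet lam) :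
    ∃ s ∈ Sbarg J lam, ∃ g, coAct g mu = rightAct s lam := by
  obtain ⟨y, hy, hxy⟩ := exists_lamE_mul_eq lam (mu - lam) (sbar_le J lam) (sbar_le J lam)
    fun x hx hxl => by rw [lamE_sub_left, hmu x ⟨hx, hxl⟩, sub_self]
  obtain ⟨s, hs, hsy⟩ := exists_mem_algSubgroup hJ (sbar_le J lam) hy
  have hs' : s⁻¹ ∈ Sbarg J lam := inv_mem hs
  refine ⟨s⁻¹, hs', exists_coAct_eq_of_agree_sChain _ hJ (Fintype.card R) mu fun x hx => ?_⟩
  rw [mem_sChain_rightAct lam _ hs'] at hx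
  have hxJ := sChain_le lam _ hx
  rw [lamE_rightAct _ lam hxJ, InvMemClass.coe_inv, inv_inv, hsy, mul_add, mul_one,
    lamE_add J lam hxJ (mul_mem hxJ (sbar_le J lam hy)), ← hxy x hx, lamE_sub_left]
  ring

theorem mem_Xi_iff (hJ : IsNil J) {nu : ↥J →ₗ[F] F} :
    nu ∈ Xi J lam ↔ ∃ x, coAct x nu ∈ agreeSet lam := by
  constructor
  · rintro ⟨g, s, hs, rfl⟩
    refine ⟨g⁻¹, ?_⟩
    rw [coAct_inv_coAct]
    exact fun x hx => lamE_rightAct_of_mem_lbar lam hs hx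
  · rintro ⟨x, hx⟩
    obtain ⟨s, hs, g, hg⟩ := exists_coAct_eq_rightAct lam hJ hx
    refine ⟨(x * g)⁻¹, s, hs, ?_⟩
    rw [← hg, coAct_coAct g x, coAct_inv_coAct]

/-- The number of `x ∈ G` for which `ν^x` agrees with `λ` on `𝔩̄_λ`. -/
def agreeCount (nu : ↥J →ₗ[F] F) : ℕ :=
  Nat.card {x : ↥(algGroup F R J) // coAct x nu ∈ agreeSet lam}

theorem agreeCount_coAct_right (g : ↥(algGroup F R J)) (nu : ↥J →ₗ[F] F) :
    agreeCount lam (coAct g nu) = agreeCount lam nu :=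
  Nat.card_congr ((Equiv.mulLeft g).subtypeEquiv fun x => by
    rw [coAct_coAct, Equiv.coe_mulLeft])

theorem agreeCount_coAct_left (g : ↥(algGroup F R J)) (nu : ↥J →ₗ[F] F) :
    agreeCount (coAct g lam) nu = agreeCount lam nu :=
  Nat.card_congr ((Equiv.mulRight g⁻¹).subtypeEquiv fun x => by
    rw [mem_agreeSet_coAct, coAct_coAct, Equiv.coe_mulRight])

theorem agreeCount_rightAct_left {s : ↥(algGroup F R J)} (hs : s ∈ Sbarg J lam)
    (nu : ↥J →ₗ[F] F) : agreeCount (rightAct s lam) nu = agreeCount lam nu := by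
  rw [agreeCount, agreeSet_rightAct lam hs]; rfl

theorem Sbarg_rightAct (hJ : IsNil J) {s : ↥(algGroup F R J)} (hs : s ∈ Sbarg J lam) :
    Sbarg J (rightAct s lam) = Sbarg J lam := by
  have : sbar J (rightAct s lam) = sbar J lam :=
    SetLike.ext (mem_sChain_rightAct lam _ hs)
  rw [Sbarg, this]; rfl

theorem agreeCount_of_mem (hJ : IsNil J) {nu : ↥J →ₗ[F] F} (hnu : nu ∈ Xi J lam) :
    agreeCount lam nu = Nat.card ↥(Sbarg J lam) := by
  obtain ⟨g, s, hs, rfl⟩ := hnu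
  rw [agreeCount_coAct_right, ← agreeCount_rightAct_left lam hs, ← Sbarg_rightAct lam hJ hs]
  exact Nat.card_congr (Equiv.subtypeEquivRight fun x => coAct_mem_agreeSet_iff _ hJ)

theorem agreeCount_eq_zero_iff (hJ : IsNil J) {nu : ↥J →ₗ[F] F} :
    agreeCount lam nu = 0 ↔ nu ∉ Xi J lam := by
  rw [mem_Xi_iff lam hJ, agreeCount, Finite.card_eq_zero_iff, isEmpty_subtype, not_exists]

theorem agreeCount_eq_of_mem {lam lam' : ↥J →ₗ[F] F} (h : lam' ∈ Xi J lam) :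
    agreeCount lam' = agreeCount lam := by
  obtain ⟨g, s, hs, rfl⟩ := h
  funext nu
  rw [agreeCount_coAct_left, agreeCount_rightAct_left lam hs]

theorem Xi_eq_of_mem (hJ : IsNil J) {lam lam' : ↥J →ₗ[F] F} (h : lam' ∈ Xi J lam) :
    Xi J lam' = Xi J lam := by
  ext nu
  rw [← not_iff_not, ← agreeCount_eq_zero_iff _ hJ, ← agreeCount_eq_zero_iff _ hJ,
    agreeCount_eq_of_mem h]

theorem mem_Xi_self (hJ : IsNil J) : lam ∈ Xi J lam :=
  (mem_Xi_iff lam hJ).2 ⟨1, by rw [coAct_one]; exact fun _ _ => rfl⟩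

theorem mem_Xi_of_mem_of_mem (hJ : IsNil J) {lam lam' nu : ↥J →ₗ[F] F} (h : nu ∈ Xi J lam)
    (h' : nu ∈ Xi J lam') : lam' ∈ Xi J lam := by
  rw [← Xi_eq_of_mem hJ h, Xi_eq_of_mem hJ h']
  exact mem_Xi_self lam' hJ

end Chains


/-! ### Fourier expansion of `ξ_λ` -/

section Fourier

variable {θ : AddChar F ℂ}

theorem exists_apply_mul_ne_one (hθ : θ ≠ 1) {t : F} (ht : t ≠ 0) : ∃ c, θ (c * t) ≠ 1 := by
  obtain ⟨a, ha⟩ := AddChar.ne_one_iff.1 hθ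
  exact ⟨a / t, by rwa [div_mul_cancel₀ _ ht]⟩

theorem sum_apply_linearMap (hθ : θ ≠ 1) {V : Type} [AddCommGroup V] [Module F V] [Fintype V]
    (f : V →ₗ[F] F) : ∑ v, θ (f v) = if f = 0 then (Nat.card V : ℂ) else 0 := by
  split_ifs with h
  · simp [h, Nat.card_eq_fintype_card]
  · obtain ⟨v, hv⟩ := DFunLike.ne_iff.1 h
    obtain ⟨c, hc⟩ := exists_apply_mul_ne_one hθ hv
    have hψ : θ.compAddMonoidHom f.toAddMonoidHom ≠ 0 := by
      refine AddChar.ne_one_iff.2 ⟨c • v, ?_⟩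
      change θ (f (c • v)) ≠ 1
      rwa [map_smul, smul_eq_mul]
    exact AddChar.sum_eq_zero_of_ne_one hψ

variable {J : NonUnitalSubalgebra F R}

instance fintypeDual : Fintype (↥J →ₗ[F] F) :=
  haveI : Finite (↥J →ₗ[F] F) :=
    Finite.of_injective (fun f => (f : ↥J → F)) DFunLike.coe_injective
  Fintype.ofFinite _

/-- The elements of `J` lying in a subalgebra `s`, as a subspace of `J`. -/
def subspaceIn (s J : NonUnitalSubalgebra F R) : Subspace F ↥J where
  carrier := {X | (X : R) ∈ s}
  zero_mem' := zero_mem s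
  add_mem' := add_mem (S := NonUnitalSubalgebra F R)
  smul_mem' c X hX := SMulMemClass.smul_mem (s := s) c (show (X : R) ∈ s from hX)

theorem mem_subspaceIn {s J : NonUnitalSubalgebra F R} {X : ↥J} :
    X ∈ subspaceIn s J ↔ (X : R) ∈ s := Iff.rfl

theorem gElt_bijective (hJ : IsNil J) :
    Function.Bijective (gElt : ↥(algGroup F R J) → ↥J) := by
  refine ⟨fun g h hgh => Subtype.ext (Units.ext ?_), fun X => ?_⟩
  · exact sub_left_injective (congrArg Subtype.val hgh)
  · obtain ⟨g, -, hg⟩ := exists_mem_algSubgroup hJ le_rfl X.2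
    exact ⟨g, Subtype.ext ((congrArg (· - 1) hg).trans (add_sub_cancel_left _ _))⟩

theorem gElt_mem_subspaceIn_iff (hJ : IsNil J) {s : NonUnitalSubalgebra F R} (hs : s ≤ J)
    {g : ↥(algGroup F R J)} : gElt g ∈ subspaceIn s J ↔ g ∈ algSubgroup s J :=
  (mem_algSubgroup_iff hJ hs).symm

theorem card_algSubgroup (hJ : IsNil J) {s : NonUnitalSubalgebra F R} (hs : s ≤ J) :
    Nat.card ↥(algSubgroup s J) = Nat.card ↥(subspaceIn s J) :=
  Nat.card_congr ((Equiv.ofBijective gElt (gElt_bijective hJ)).subtypeEquiv fun _ =>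
    (gElt_mem_subspaceIn_iff hJ hs).symm)

theorem card_mul_card_dualAnnihilator {V : Type} [AddCommGroup V] [Module F V] [Finite V]
    (W : Subspace F V) : Nat.card ↥W * Nat.card ↥W.dualAnnihilator = Nat.card V := by
  rw [Module.natCard_eq_pow_finrank (K := F) (V := V),
    ← Subspace.finrank_add_finrank_dualAnnihilator_eq W, pow_add,
    ← Module.natCard_eq_pow_finrank]
  exact congrArg _ (Module.natCard_eq_pow_finrank (K := F) (V := ↥W.dualAnnihilator))

theorem card_Lbarg_mul (hJ : IsNil J) (lam : ↥J →ₗ[F] F) :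
    Nat.card ↥(Lbarg J lam) * Nat.card ↥(subspaceIn (lbar J lam) J).dualAnnihilator =
      Nat.card ↥(algGroup F R J) := by
  rw [Lbarg, card_algSubgroup hJ (lbar_le J lam), card_mul_card_dualAnnihilator]
  exact (Nat.card_congr (Equiv.ofBijective gElt (gElt_bijective hJ))).symm

theorem innerG_thetaFn (hJ : IsNil J) (hθ : θ ≠ 1) (mu nu : ↥J →ₗ[F] F) :
    innerG ↥(algGroup F R J) (thetaFn θ J mu) (thetaFn θ J nu) = if mu = nu then 1 else 0 := by
  have h (g : ↥(algGroup F R J)) : thetaFn θ J mu g * (starRingEnd ℂ) (thetaFn θ J nu g) =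
      θ ((mu - nu) (gElt g)) := by
    rw [thetaFn, thetaFn, ← AddChar.map_neg_eq_conj, ← AddChar.map_add_eq_mul,
      LinearMap.sub_apply, sub_eq_add_neg]
  simp_rw [innerG_eq_sum, h]
  rw [(gElt_bijective hJ).sum_comp fun X => θ ((mu - nu) X), sum_apply_linearMap hθ,
    Nat.card_congr (Equiv.ofBijective gElt (gElt_bijective hJ))]
  simp only [sub_eq_zero]
  split_ifs
  · exact inv_mul_cancel₀ (Nat.cast_ne_zero.2 Nat.card_pos.ne')
  · exact mul_zero _

theorem thetaFn_conj (mu : ↥J →ₗ[F] F) (x g : ↥(algGroup F R J)) :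
    thetaFn θ J mu (x * g * x⁻¹) = thetaFn θ J (coAct x mu) g := by
  refine congrArg (fun X => θ (mu X)) (Subtype.ext ?_)
  simp [gElt, lmulMap, rmulMap, mul_sub, sub_mul, mul_assoc]

theorem mem_agreeSet_iff_sub_mem {lam mu : ↥J →ₗ[F] F} :
    mu ∈ agreeSet lam ↔ mu - lam ∈ (subspaceIn (lbar J lam) J).dualAnnihilator := by
  rw [mem_agreeSet, Submodule.mem_dualAnnihilator]
  refine ⟨fun h X hX => ?_, fun h x hx => ?_⟩
  · rw [LinearMap.sub_apply, sub_eq_zero, ← lamE_coe, ← lamE_coe]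
    exact h _ hX
  · have hxJ := lbar_le J lam hx
    have := h ⟨x, hxJ⟩ hx
    rwa [LinearMap.sub_apply, sub_eq_zero, ← lamE_apply, ← lamE_apply] at this

theorem sum_agreeSet_thetaFn (hJ : IsNil J) (hθ : θ ≠ 1) (lam : ↥J →ₗ[F] F)
    (y : ↥(algGroup F R J)) :
    ∑ mu, (if mu ∈ agreeSet lam then thetaFn θ J mu y else 0) =
      if y ∈ Lbarg J lam then
        (Nat.card ↥(subspaceIn (lbar J lam) J).dualAnnihilator : ℂ) * thetaFn θ J lam y
      else 0 := by
  let W := subspaceIn (lbar J lam) J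
  have h1 : ∑ mu, (if mu ∈ agreeSet lam then thetaFn θ J mu y else 0) =
      thetaFn θ J lam y * ∑ nu : ↥W.dualAnnihilator, θ ((nu : Module.Dual F ↥J) (gElt y)) := by
    rw [← Finset.sum_filter, Finset.mul_sum]
    refine (Finset.sum_nbij' (fun nu : ↥W.dualAnnihilator => lam + (nu : Module.Dual F ↥J))
      (fun mu => if h : mu - lam ∈ W.dualAnnihilator then ⟨mu - lam, h⟩ else 0)
      ?_ ?_ ?_ ?_ ?_).symm
    · intro nu _
      rw [Finset.mem_filter, mem_agreeSet_iff_sub_mem, add_sub_cancel_left]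
      exact ⟨Finset.mem_univ _, nu.2⟩
    · exact fun _ _ => Finset.mem_univ _
    · intro nu _
      simp
    · intro mu hmu
      rw [Finset.mem_filter, mem_agreeSet_iff_sub_mem] at hmu
      rw [dif_pos hmu.2, add_sub_cancel]
    · intro nu _
      rw [thetaFn, thetaFn, LinearMap.add_apply, AddChar.map_add_eq_mul]
  have h2 : ((Module.Dual.eval F ↥J (gElt y)).domRestrict W.dualAnnihilator = 0) ↔
      y ∈ Lbarg J lam := by
    rw [Lbarg, ← gElt_mem_subspaceIn_iff hJ (lbar_le J lam),
      ← Subspace.forall_mem_dualAnnihilator_apply_eq_zero_iff]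
    exact ⟨fun h φ hφ => LinearMap.congr_fun h ⟨φ, hφ⟩, fun h => LinearMap.ext fun φ => h φ φ.2⟩
  have h3 := sum_apply_linearMap hθ (V := ↥W.dualAnnihilator)
    ((Module.Dual.eval F ↥J (gElt y)).domRestrict W.dualAnnihilator)
  rw [h1]
  simp only [h2] at h3
  refine (congrArg _ h3).trans ?_
  rw [mul_ite, mul_zero, mul_comm]

theorem xi_eq_sum (hJ : IsNil J) (hθ : θ ≠ 1) (lam : ↥J →ₗ[F] F) (g : ↥(algGroup F R J)) :
    xi θ J lam g = (Nat.card ↥(algGroup F R J) : ℂ)⁻¹ *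
      ∑ nu, (agreeCount lam nu : ℂ) * thetaFn θ J nu g := by
  let W := subspaceIn (lbar J lam) J
  have hW : (Nat.card ↥W.dualAnnihilator : ℂ) ≠ 0 := Nat.cast_ne_zero.2 Nat.card_pos.ne'
  have hx (x : ↥(algGroup F R J)) :
      (if h : x * g * x⁻¹ ∈ Lbarg J lam then thetaFn θ J lam (x * g * x⁻¹) else 0) =
        (Nat.card ↥W.dualAnnihilator : ℂ)⁻¹ *
          ∑ nu, if coAct x⁻¹ nu ∈ agreeSet lam then thetaFn θ J nu g else 0 := by
    have h1 : ∑ nu, (if coAct x⁻¹ nu ∈ agreeSet lam then thetaFn θ J nu g else 0) =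
        ∑ mu, if mu ∈ agreeSet lam then thetaFn θ J mu (x * g * x⁻¹) else 0 := by
      refine Fintype.sum_bijective (coAct x⁻¹) ?_ _ _ fun nu => ?_
      · exact Function.bijective_iff_has_inverse.2
          ⟨coAct x, coAct_coAct_inv x, coAct_inv_coAct x⟩
      · rw [thetaFn_conj, coAct_coAct_inv]
    rw [h1, sum_agreeSet_thetaFn hJ hθ, mul_ite, mul_zero, inv_mul_cancel_left₀ hW]
    rfl
  rw [xi, indFun_eq_sum]
  simp_rw [hx]
  rw [← Finset.mul_sum, ← mul_assoc, ← mul_inv, ← Nat.cast_mul, card_Lbarg_mul hJ,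
    Finset.sum_comm]
  congr 1
  refine Finset.sum_congr rfl fun nu _ => ?_
  rw [← Finset.sum_filter, Finset.sum_const, nsmul_eq_mul, agreeCount,
    Nat.card_congr ((Equiv.inv _).subtypeEquiv (q := fun x => coAct x⁻¹ nu ∈ agreeSet lam)
      fun x => by rw [Equiv.inv_apply, inv_inv]),
    Nat.card_eq_fintype_card, Fintype.card_subtype]

theorem innerG_sum_mul (hJ : IsNil J) (hθ : θ ≠ 1) (c : ℂ) (a b : (↥J →ₗ[F] F) → ℕ) :
    innerG ↥(algGroup F R J) (fun g => c⁻¹ * ∑ nu, (a nu : ℂ) * thetaFn θ J nu g)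
      (fun g => c⁻¹ * ∑ nu, (b nu : ℂ) * thetaFn θ J nu g) =
      c⁻¹ * (starRingEnd ℂ) c⁻¹ * ∑ nu, (a nu : ℂ) * b nu := by
  have h (g : ↥(algGroup F R J)) : (c⁻¹ * ∑ nu, (a nu : ℂ) * thetaFn θ J nu g) *
      (starRingEnd ℂ) (c⁻¹ * ∑ nu, (b nu : ℂ) * thetaFn θ J nu g) =
      ∑ mu, ∑ nu, (c⁻¹ * (starRingEnd ℂ) c⁻¹ * (a mu * b nu)) *
        (thetaFn θ J mu g * (starRingEnd ℂ) (thetaFn θ J nu g)) := by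
    rw [map_mul, map_sum, mul_mul_mul_comm, Finset.sum_mul_sum, Finset.mul_sum]
    refine Finset.sum_congr rfl fun mu _ => ?_
    rw [Finset.mul_sum]
    refine Finset.sum_congr rfl fun nu _ => ?_
    rw [map_mul, Complex.conj_natCast]
    ring
  rw [innerG_eq_sum]
  simp_rw [h]
  rw [Finset.sum_comm, Finset.mul_sum, Finset.mul_sum]
  refine Finset.sum_congr rfl fun mu _ => ?_
  rw [Finset.sum_comm, Finset.mul_sum]
  have h' (nu) : (Nat.card ↥(algGroup F R J) : ℂ)⁻¹ * ∑ g,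
      (c⁻¹ * (starRingEnd ℂ) c⁻¹ * (a mu * b nu)) *
        (thetaFn θ J mu g * (starRingEnd ℂ) (thetaFn θ J nu g)) =
      (c⁻¹ * (starRingEnd ℂ) c⁻¹ * (a mu * b nu)) * if mu = nu then 1 else 0 := by
    rw [← innerG_thetaFn hJ hθ, innerG_eq_sum, ← Finset.mul_sum, mul_left_comm]
  simp_rw [h']
  simp

theorem innerG_xi (hJ : IsNil J) (hθ : θ ≠ 1) (lam lam' : ↥J →ₗ[F] F) :
    innerG ↥(algGroup F R J) (xi θ J lam) (xi θ J lam') =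
      (Nat.card ↥(algGroup F R J) : ℂ)⁻¹ * (Nat.card ↥(algGroup F R J) : ℂ)⁻¹ *
        ∑ nu, (agreeCount lam nu : ℂ) * agreeCount lam' nu := by
  rw [funext (xi_eq_sum hJ hθ lam), funext (xi_eq_sum hJ hθ lam'), innerG_sum_mul hJ hθ, map_inv₀,
    Complex.conj_natCast]

theorem thetaFn_one (lam : ↥J →ₗ[F] F) : thetaFn θ J lam 1 = 1 := by
  have : gElt (1 : ↥(algGroup F R J)) = 0 := Subtype.ext (sub_self 1)
  rw [thetaFn, this, map_zero, AddChar.map_zero_eq_one]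

theorem xi_one (lam : ↥J →ₗ[F] F) : xi θ J lam 1 =
    (Nat.card ↥(Lbarg J lam) : ℂ)⁻¹ * Nat.card ↥(algGroup F R J) := by
  rw [xi, indFun_eq_sum]
  simp [one_mem, thetaFn_one, Nat.card_eq_fintype_card]

theorem sum_agreeCount (hJ : IsNil J) (hθ : θ ≠ 1) (lam : ↥J →ₗ[F] F) :
    ∑ nu, (agreeCount lam nu : ℂ) = (Nat.card ↥(Lbarg J lam) : ℂ)⁻¹ *
      (Nat.card ↥(algGroup F R J) * Nat.card ↥(algGroup F R J)) := by
  have h := xi_eq_sum hJ hθ lam 1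
  simp only [thetaFn_one, mul_one, xi_one] at h
  have hG : (Nat.card ↥(algGroup F R J) : ℂ) ≠ 0 := Nat.cast_ne_zero.2 Nat.card_pos.ne'
  rw [eq_inv_mul_iff_mul_eq₀ hG] at h
  rw [← h]
  ring

theorem innerG_xi_self (hJ : IsNil J) (hθ : θ ≠ 1) (lam : ↥J →ₗ[F] F) :
    innerG ↥(algGroup F R J) (xi θ J lam) (xi θ J lam) =
      (Nat.card ↥(Sbarg J lam) : ℂ) / (Nat.card ↥(Lbarg J lam) : ℂ) := by
  have h (nu) : (agreeCount lam nu : ℂ) * agreeCount lam nu =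
      Nat.card ↥(Sbarg J lam) * agreeCount lam nu := by
    by_cases hnu : nu ∈ Xi J lam
    · rw [agreeCount_of_mem lam hJ hnu]
    · rw [(agreeCount_eq_zero_iff lam hJ).2 hnu, Nat.cast_zero, mul_zero, mul_zero]
  have hG : (Nat.card ↥(algGroup F R J) : ℂ) ≠ 0 := Nat.cast_ne_zero.2 Nat.card_pos.ne'
  simp_rw [innerG_xi hJ hθ, h]
  rw [← Finset.mul_sum, sum_agreeCount hJ hθ]
  field_simp

theorem innerG_xi_eq_zero (hJ : IsNil J) (hθ : θ ≠ 1) {lam lam' : ↥J →ₗ[F] F}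
    (h : lam' ∉ Xi J lam) : innerG ↥(algGroup F R J) (xi θ J lam) (xi θ J lam') = 0 := by
  rw [innerG_xi hJ hθ, Finset.sum_eq_zero, mul_zero]
  intro nu _
  by_cases hnu : nu ∈ Xi J lam
  · have hnu' : nu ∉ Xi J lam' := fun hnu' => h (mem_Xi_of_mem_of_mem hJ hnu hnu')
    rw [(agreeCount_eq_zero_iff lam' hJ).2 hnu', Nat.cast_zero, mul_zero]
  · rw [(agreeCount_eq_zero_iff lam hJ).2 hnu, Nat.cast_zero, zero_mul]

theorem xi_eq_of_mem (hJ : IsNil J) (hθ : θ ≠ 1) {lam lam' : ↥J →ₗ[F] F}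
    (h : lam' ∈ Xi J lam) : xi θ J lam = xi θ J lam' := by
  funext g
  rw [xi_eq_sum hJ hθ, xi_eq_sum hJ hθ, agreeCount_eq_of_mem h]

end Fourier

/-! ### Irreducible constituents -/

section Constituents

variable {θ : AddChar F ℂ} {J : NonUnitalSubalgebra F R}

/-- The linear character of `L̄_λ` obtained by restricting `θ_λ`. -/
def thetaHom (θ : AddChar F ℂ) (J : NonUnitalSubalgebra F R) (lam : ↥J →ₗ[F] F) :
    ↥(Lbarg J lam) →* ℂ where
  toFun l := thetaFn θ J lam l
  map_one' := thetaFn_one lam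
  map_mul' l m := by
    have hl : (((l : ↥(algGroup F R J)) : Rˣ) : R) - 1 ∈ lbar J lam := l.2.1
    have hm : (((m : ↥(algGroup F R J)) : Rˣ) : R) - 1 ∈ lbar J lam := m.2.1
    have h : ((((l * m : ↥(Lbarg J lam)) : ↥(algGroup F R J)) : Rˣ) : R) - 1 =
        ((((l : ↥(algGroup F R J)) : Rˣ) : R) - 1) * ((((m : ↥(algGroup F R J)) : Rˣ) : R) - 1) +
          ((((l : ↥(algGroup F R J)) : Rˣ) : R) - 1) +
          ((((m : ↥(algGroup F R J)) : Rˣ) : R) - 1) := by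
      push_cast; noncomm_ring
    simp only [thetaFn]
    rw [← AddChar.map_add_eq_mul, ← lamE_coe, ← lamE_coe lam (gElt ↑l), ← lamE_coe lam (gElt ↑m)]
    simp only [gElt]
    rw [h, lamE_add J lam (lbar_le J lam (add_mem (mul_mem hl hm) hl)) (lbar_le J lam hm),
      lamE_add J lam (lbar_le J lam (mul_mem hl hm)) (lbar_le J lam hl), hl.2 _ hm.1, zero_add]

theorem thetaHom_inv (lam : ↥J →ₗ[F] F) (l : ↥(Lbarg J lam)) :
    thetaHom θ J lam l⁻¹ = (starRingEnd ℂ) (thetaHom θ J lam l) := by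
  have h1 : thetaHom θ J lam l⁻¹ * thetaHom θ J lam l = 1 := by
    rw [← map_mul, inv_mul_cancel, map_one]
  rw [eq_inv_of_mul_eq_one_left h1]
  exact θ.inv_apply_eq_conj _

/-- If `λ' ∉ Ξ_λ`, then the linear character of `L̄_λ` and the conjugate by `x` of that of
`L̄_λ'` differ on `L̄_λ ∩ x L̄_λ' x⁻¹`; otherwise some functional in `Ξ_λ ∩ Ξ_λ'` would extend
both `λ` on `𝔩̄_λ` and the conjugate of `λ'`. -/
theorem exists_ne_of_notMem_Xi (hJ : IsNil J) (hθ : θ ≠ 1) {lam lam' : ↥J →ₗ[F] F}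
    (h : lam' ∉ Xi J lam) (x : ↥(algGroup F R J)) :
    ∃ (l : ↥(Lbarg J lam)) (l' : ↥(Lbarg J lam')),
      (l : ↥(algGroup F R J)) * x = x * l' ∧ thetaHom θ J lam l ≠ thetaHom θ J lam' l' := by
  by_contra! hcon
  refine h ?_
  let A := subspaceIn (lbar J lam) J
  let B := subspaceIn (lbar J (coAct x⁻¹ lam')) J
  have hAB : coAct x⁻¹ lam' - lam ∈ A.dualAnnihilator ⊔ B.dualAnnihilator := by
    rw [← Subspace.dualAnnihilator_inf_eq, Submodule.mem_dualAnnihilator]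
    rintro X ⟨hXA, hXB⟩
    by_contra hX
    obtain ⟨c, hc⟩ := exists_apply_mul_ne_one hθ hX
    obtain ⟨l, hl, hlX⟩ := exists_mem_algSubgroup hJ (lbar_le J lam)
      (SMulMemClass.smul_mem c (mem_subspaceIn.1 hXA))
    have hlX' : gElt l = c • X :=
      Subtype.ext ((congrArg (· - 1) hlX).trans (add_sub_cancel_left _ _))
    have hl' : x⁻¹ * l * x⁻¹⁻¹ ∈ Lbarg J lam' := by
      refine (mem_algSubgroup_iff hJ (lbar_le J lam')).2 ?_
      have h1 := (mem_lbar_coAct lam' x⁻¹ _).1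
        (SMulMemClass.smul_mem c (mem_subspaceIn.1 hXB))
      rw [← add_sub_cancel_left 1 (c • (X : R)), ← hlX, unitConj_apply] at h1
      convert h1 using 1
      simp [mul_sub, sub_mul]
    have h2 := hcon ⟨l, hl⟩ ⟨_, hl'⟩ (by group)
    change thetaFn θ J lam l = thetaFn θ J lam' _ at h2
    rw [thetaFn_conj, thetaFn, thetaFn, hlX'] at h2
    refine hc ?_
    rw [← smul_eq_mul, ← map_smul, LinearMap.sub_apply, AddChar.map_sub_eq_div, ← h2,
      div_self ((θ.val_isUnit _).ne_zero)]
  obtain ⟨α, hα, β, hβ, hαβ⟩ := Submodule.mem_sup.1 hAB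
  have hmu : lam + α ∈ Xi J lam := (mem_Xi_iff lam hJ).2
    ⟨1, by rw [coAct_one, mem_agreeSet_iff_sub_mem, add_sub_cancel_left]; exact hα⟩
  have hmu' : lam + α ∈ Xi J lam' := by
    refine (mem_Xi_iff lam' hJ).2 ⟨x, ?_⟩
    rw [← inv_inv x, ← mem_agreeSet_coAct, mem_agreeSet_iff_sub_mem]
    have : lam + α - coAct x⁻¹ lam' = -β := by
      rw [← sub_add_cancel (coAct x⁻¹ lam') lam, ← hαβ]; abel
    rw [this]
    exact neg_mem hβ
  exact mem_Xi_of_mem_of_mem hJ hmu hmu'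

theorem IrrConstituents_xi_inter_eq_empty (hJ : IsNil J) (hθ : θ ≠ 1) {lam lam' : ↥J →ₗ[F] F}
    (h : lam' ∉ Xi J lam) :
    IrrConstituents ↥(algGroup F R J) (xi θ J lam) ∩
      IrrConstituents ↥(algGroup F R J) (xi θ J lam') = ∅ := by
  refine Set.eq_empty_of_forall_notMem ?_
  rintro _ ⟨⟨⟨⟨V, rfl⟩, hV⟩, h1⟩, -, h2⟩
  rcases trace_eq_zero_or_of_mul_eq_zero V.ρ hV (twistedSum V.ρ (thetaHom θ J lam))
    (twistedSum V.ρ (thetaHom θ J lam')) fun x => by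
      obtain ⟨l, l', hx, hne⟩ := exists_ne_of_notMem_Xi hJ hθ h x
      exact twistedSum_mul_mul_twistedSum_eq_zero V.ρ _ _ x l l' hx hne with h0 | h0
  · exact trace_twistedSum_ne_zero V.ρ _ (thetaHom_inv lam) h1.ne' h0
  · exact trace_twistedSum_ne_zero V.ρ _ (thetaHom_inv lam') h2.ne' h0

end Constituents

theorem statement10 (F : Type) [Field F] [Fintype F]
    (R : Type) [Ring R] [Algebra F R] [Fintype R]
    (J : NonUnitalSubalgebra F R) (hJ : IsNil J)
    (θ : AddChar F ℂ) (hθ : θ ≠ 1)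
    (lam lam' : ↥J →ₗ[F] F) :
    (xi θ J lam = xi θ J lam' ↔ lam' ∈ Xi J lam) ∧
    (lam' ∉ Xi J lam →
      IrrConstituents ↥(algGroup F R J) (xi θ J lam) ∩
        IrrConstituents ↥(algGroup F R J) (xi θ J lam') = ∅) ∧
    innerG ↥(algGroup F R J) (xi θ J lam) (xi θ J lam') =
      (if lam' ∈ Xi J lam then
        (Nat.card ↥(Sbarg J lam) : ℂ) / (Nat.card ↥(Lbarg J lam) : ℂ) else 0) := by
  have hself : lam' ∈ Xi J lam → innerG ↥(algGroup F R J) (xi θ J lam) (xi θ J lam') =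
      (Nat.card ↥(Sbarg J lam) : ℂ) / (Nat.card ↥(Lbarg J lam) : ℂ) := fun h => by
    rw [← xi_eq_of_mem hJ hθ h, innerG_xi_self hJ hθ]
  refine ⟨⟨fun h => ?_, xi_eq_of_mem hJ hθ⟩, IrrConstituents_xi_inter_eq_empty hJ hθ, ?_⟩
  · by_contra hmem
    have h0 := innerG_xi_eq_zero hJ hθ hmem
    rw [← h, innerG_xi_self hJ hθ] at h0
    exact div_ne_zero (Nat.cast_ne_zero.2 Nat.card_pos.ne') (Nat.cast_ne_zero.2 Nat.card_pos.ne') h0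
  · split_ifs with h
    · exact hself h
    · exact innerG_xi_eq_zero hJ hθ h

end IterChar
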